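/- Let k be a field and X a scheme which is separated and of finite type over k but not proper over k. Then there exists a closed subscheme C of X, i.e., a scheme C together with a closed immersion C → X over k, such that C is affine, integral, and of Krull dimension one; in particular, the k-vector space Γ(C, O_C) of global sections of the structure sheaf of C is infinite-dimensional over k. -/

import Mathlib

section
open Polynomial

namespace AffCurve

section Core
variable {k F : Type*} [Field k] [Field F] [Algebra k F]

lemma exists_dvd_poly (htr : Algebra.trdeg k F ≤ 1) {x : F} (hx : Transcendental k x)
    {y : F} (hy : y ≠ 0) :
    ∃ c : k[X], c ≠ 0 ∧ ∃ w ∈ Algebra.adjoin k {x, y}, aeval x c = y * w := by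
  have h1 : AlgebraicIndependent k (fun _ : PUnit.{1} => x) := by
    rw [algebraicIndependent_unique_type_iff]; exact hx
  have halg : IsAlgebraic (Algebra.adjoin k (Set.range (fun _ : PUnit.{1} => x))) y := by
    by_contra hcon
    have := (h1.option_iff_transcendental y).2 hcon
    have h2 := this.lift_cardinalMk_le_trdeg
    have h3 := h2.trans (Cardinal.lift_le.2 htr)
    simp at h3
  obtain ⟨p, hp0, hp⟩ := halg.exists_nonzero_coeff_and_aeval_eq_zero
    (mem_nonZeroDivisors_of_ne_zero hy)
  have hrange : Set.range (fun _ : PUnit.{1} => x) = {x} := by simp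
  have hc : ((p.coeff 0 : _) : F) ∈ Algebra.adjoin k {x} :=
    Algebra.adjoin_mono hrange.le (p.coeff 0).2
  rw [Algebra.adjoin_singleton_eq_range_aeval] at hc
  obtain ⟨c, hc⟩ := hc
  refine ⟨-c, ?_, aeval y p.divX, ?_, ?_⟩
  · rintro h
    rw [neg_eq_zero] at h
    apply hp0
    ext
    rw [← hc, h]; simp
  · have hsub : ∀ q : (Algebra.adjoin k (Set.range (fun _ : PUnit.{1} => x)))[X],
        aeval y q ∈ Algebra.adjoin k {x, y} := by
      intro q
      rw [aeval_eq_sum_range]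
      refine Subalgebra.sum_mem _ fun i _ => ?_
      rw [Algebra.smul_def]
      refine Subalgebra.mul_mem _ ?_ (Subalgebra.pow_mem _ (Algebra.subset_adjoin (by simp)) _)
      exact Algebra.adjoin_mono (by rw [hrange]; simp) (q.coeff i).2
    exact hsub _
  · have h := congrArg (aeval y) (divX_mul_X_add p)
    rw [hp] at h
    simp only [map_add, map_mul, aeval_X, aeval_C] at h
    have hc' : aeval x c = (algebraMap (Algebra.adjoin k (Set.range (fun _ : PUnit.{1} => x))) F)
        (p.coeff 0) := hc
    rw [map_neg, hc']
    linear_combination -h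

lemma transcendental_of_mem_maximalIdeal (R : Subalgebra k F) [IsLocalRing R] (x : R)
    (hx : x ∈ IsLocalRing.maximalIdeal R) (hx0 : (x : F) ≠ 0) : Transcendental k (x : F) := by
  intro halg
  have := R.inv_mem_of_algebraic halg
  apply hx
  exact IsUnit.of_mul_eq_one ⟨_, this⟩ (by ext; simp [hx0])

lemma arch (htr : Algebra.trdeg k F ≤ 1) (R : Subalgebra k F) [IsLocalRing R] (x : R)
    (hx : x ∈ IsLocalRing.maximalIdeal R) (hx0 : (x : F) ≠ 0) (d : R) (hd : (d : F) ≠ 0) :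
    ∃ N : ℕ, ∃ w : R, x ^ N = d * w := by
  obtain ⟨c, hc0, w, hw, h⟩ := exists_dvd_poly htr
    (transcendental_of_mem_maximalIdeal R x hx hx0) hd
  have hwR : w ∈ R := by
    refine (Algebra.adjoin_le ?_ : _ ≤ R) hw
    rintro _ (rfl | rfl)
    · exact x.2
    · exact d.2
  obtain ⟨c', hc', hnd⟩ := exists_eq_pow_rootMultiplicity_mul_and_not_dvd c hc0 0
  set N := c.rootMultiplicity 0
  simp only [map_zero, sub_zero] at hc' hnd
  rw [X_dvd_iff] at hnd
  have hu : IsUnit (aeval x c') := by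
    rw [← divX_mul_X_add c']
    simp only [map_add, map_mul, aeval_X, aeval_C]
    by_contra hnu
    have h1 : (algebraMap k R) (c'.coeff 0) ∈ IsLocalRing.maximalIdeal R := by
      have := Ideal.sub_mem _ ((IsLocalRing.mem_maximalIdeal _).2 hnu)
        (Ideal.mul_mem_left _ (aeval x c'.divX) hx)
      simpa using this
    exact h1 ((IsUnit.mk0 _ hnd).map _)
  obtain ⟨u, hu⟩ := hu
  refine ⟨N, ⟨w, hwR⟩ * ↑u⁻¹, ?_⟩
  have h2 : aeval x c = d * (⟨w, hwR⟩ : R) := by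
    ext
    rw [← Subalgebra.val_apply, ← aeval_algHom_apply]
    simpa using h
  rw [hc', map_mul, ← hu, map_pow, aeval_X] at h2
  rw [← mul_assoc, ← h2]; simp

/-- if `1 ∈ m O[t]` then high powers of `t⁻¹` bring everything in `O`. -/
lemma eventually_mem (htr : Algebra.trdeg k F ≤ 1) (O : Subalgebra k F) [IsLocalRing O]
    [IsFractionRing O F] (t : F) (ht : t ≠ 0) (p : O[X])
    (hp : ∀ n, p.coeff n ∈ IsLocalRing.maximalIdeal O) (hpt : aeval t p = 1) (x : F) :
    ∃ J : ℕ, ∀ j ≥ J, (t⁻¹) ^ j * x ∈ O := by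
  set s := t⁻¹ with hs
  have hintg : IsIntegral O s := by
    let p' : O[X] := 1 - p
    have hu : IsUnit (p'.coeff 0) := by
      by_contra hnu
      have := Ideal.add_mem _ ((IsLocalRing.mem_maximalIdeal _).2 hnu) (hp 0)
      simp only [p', coeff_sub, sub_add_cancel, coeff_one_zero] at this
      exact this isUnit_one
    have h0 : aeval t p' = 0 := by simp [p', hpt]
    let _ : Invertible t := invertibleOfNonzero ht
    have h1 := (eval₂_reverse_eq_zero_iff (algebraMap O F) t p').2 h0
    have hlead : p'.reverse.leadingCoeff = p'.coeff 0 := by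
      rw [reverse_leadingCoeff, trailingCoeff, natTrailingDegree_eq_zero.2 (Or.inr hu.ne_zero)]
    refine ⟨C ((hu.unit⁻¹ : Oˣ) : O) * p'.reverse, ?_, ?_⟩
    · rw [Monic, leadingCoeff_mul, leadingCoeff_C, hlead]
      simp
    · rw [eval₂_mul]
      have : (⅟t) = s := by rw [invOf_eq_inv]
      rw [this] at h1
      rw [h1, mul_zero]
  obtain ⟨e, he, hes⟩ := hintg.isAlmostIntegral
  have he0 : (e : F) ≠ 0 := by
    have := nonZeroDivisors.ne_zero he
    simpa using this
  obtain ⟨a, d, hd, hx⟩ := IsFractionRing.div_surjective (A := O) x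
  have hd0 : (d : F) ≠ 0 := by
    have := nonZeroDivisors.ne_zero hd
    simpa using this
  let O' := Algebra.adjoin O {s}
  let s' : O' := ⟨s, Algebra.subset_adjoin (by simp)⟩
  have heO : ∀ y : O', (e : F) * y ∈ O := by
    rintro ⟨y, hy⟩
    change (e : F) * y ∈ O
    replace hy : y ∈ Algebra.adjoin O {s} := hy
    rw [Algebra.adjoin_singleton_eq_range_aeval] at hy
    obtain ⟨q, rfl⟩ := hy
    simp only [AlgHom.toRingHom_eq_coe, RingHom.coe_coe]
    rw [aeval_eq_sum_range, Finset.mul_sum]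
    refine Subalgebra.sum_mem _ fun i _ => ?_
    obtain ⟨z, hz⟩ := hes i
    have : (e : F) * (q.coeff i • s ^ i) = q.coeff i * z := by
      have hz' : (z : F) = e * s ^ i := by
        rw [Algebra.smul_def] at hz; exact hz
      rw [hz', Algebra.smul_def]
      change (e : F) * ((q.coeff i : F) * s ^ i) = _
      ring
    rw [this]
    exact (q.coeff i * z).2
  have hrad : s' ∈ (Ideal.span {algebraMap O O' (e * d)}).radical := by
    rw [Ideal.radical_eq_sInf, Ideal.mem_sInf]
    rintro Q ⟨hQ, hQp⟩
    have hmQ : ∀ y ∈ IsLocalRing.maximalIdeal O, algebraMap O O' y ∈ Q := by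
      intro y hy
      by_cases hy0 : (y : F) = 0
      · have : y = 0 := by ext; simpa using hy0
        rw [this, map_zero]; exact Q.zero_mem
      obtain ⟨N, w, hN⟩ := arch htr O y hy hy0 (e * d) (by simp [he0, hd0])
      refine hQp.mem_of_pow_mem N ?_
      rw [← map_pow, hN, map_mul]
      exact Ideal.mul_mem_right _ _ (hQ (Ideal.subset_span rfl))
    refine hQp.mem_of_pow_mem p.natDegree ?_
    have hsum : s' ^ p.natDegree = ∑ i ∈ Finset.range (p.natDegree + 1),
        algebraMap O O' (p.coeff i) * s' ^ (p.natDegree - i) := by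
      ext
      rw [aeval_eq_sum_range] at hpt
      simp only [AddSubmonoidClass.coe_finsetSum, MulMemClass.coe_mul, SubmonoidClass.coe_pow, s']
      calc s ^ p.natDegree = s ^ p.natDegree * ∑ i ∈ Finset.range (p.natDegree + 1),
            p.coeff i • t ^ i := by rw [hpt, mul_one]
        _ = _ := by
          rw [Finset.mul_sum]
          refine Finset.sum_congr rfl fun i hi => ?_
          have hi' : i ≤ p.natDegree := by simp at hi; omega
          rw [Algebra.smul_def]
          change s ^ p.natDegree * ((p.coeff i : F) * t ^ i) = (p.coeff i : F) * s ^ _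
          rw [hs, inv_pow, inv_pow, ← pow_sub_mul_pow t hi']
          have := pow_ne_zero i ht
          have := pow_ne_zero (p.natDegree - i) ht
          field_simp
    rw [hsum]
    exact Ideal.sum_mem _ fun i _ => Ideal.mul_mem_right _ _ (hmQ _ (hp i))
  obtain ⟨J, hJ⟩ := Ideal.mem_radical_iff.1 hrad
  obtain ⟨w, hw⟩ := Ideal.mem_span_singleton'.1 hJ
  refine ⟨J, fun j hj => ?_⟩
  have hw' : s ^ J = w * (e * d) := congrArg (Subtype.val) hw.symm
  have : s ^ j * x = a * (e * (s' ^ (j - J) * w : O')) := by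
    rw [← hx, ← Nat.sub_add_cancel hj, pow_add, hw']
    simp only [Nat.add_sub_cancel, MulMemClass.coe_mul, SubmonoidClass.coe_pow, s']
    change _ * (_ / (d : F)) = (a : F) * _
    change _ * ((a : F) / (d : F)) = (a : F) * _
    field_simp
  rw [this]
  exact O.mul_mem a.2 (heO _)

end Core
end AffCurve
end

section
open Polynomial IntermediateField

namespace AffCurve

section Core2
variable {k F : Type*} [Field k] [Field F] [Algebra k F]

/-- A valuation subring containing `k`, as a subalgebra. -/
def vsAlg (V : ValuationSubring F) (hV : ∀ c : k, algebraMap k F c ∈ V) : Subalgebra k F :=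
  { V.toSubring.toSubsemiring with algebraMap_mem' := hV }

lemma mem_vsAlg (V : ValuationSubring F) (hV : ∀ c : k, algebraMap k F c ∈ V) (x : F) :
    x ∈ vsAlg V hV ↔ x ∈ V := Iff.rfl

lemma V_arch (htr : Algebra.trdeg k F ≤ 1) (V : ValuationSubring F)
    (hV : ∀ c : k, algebraMap k F c ∈ V) (v : F) (hv : V.valuation v < 1) (x : F) :
    ∃ N : ℕ, ∀ n ≥ N, V.valuation (v ^ n * x) < 1 := by
  by_cases hv0 : v = 0
  · refine ⟨1, fun n hn => ?_⟩
    rw [hv0, zero_pow (by omega)]; simp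
  have key : ∃ N : ℕ, V.valuation (v ^ N * x) ≤ 1 := by
    by_cases hx : x ∈ V
    · exact ⟨0, by simpa using (V.valuation_le_one_iff x).2 hx⟩
    have hx0 : x ≠ 0 := by rintro rfl; exact hx V.zero_mem
    have hd : x⁻¹ ∈ V := (V.mem_or_inv_mem x).resolve_left hx
    let R := vsAlg V hV
    have : IsLocalRing R := inferInstanceAs (IsLocalRing V)
    have hvV : v ∈ V := (V.valuation_le_one_iff v).1 hv.le
    obtain ⟨N, w, hN⟩ := arch htr R ⟨v, hvV⟩
      ((V.valuation_lt_one_iff (⟨v, hvV⟩ : V)).2 hv) hv0 ⟨x⁻¹, hd⟩ (by simpa using hx0)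
    refine ⟨N, ?_⟩
    have hN' : v ^ N = x⁻¹ * w := congrArg Subtype.val hN
    rw [hN', mul_comm x⁻¹, mul_assoc, inv_mul_cancel₀ hx0, mul_one]
    exact (V.valuation_le_one_iff _).2 w.2
  obtain ⟨N, hN⟩ := key
  refine ⟨N + 1, fun n hn => ?_⟩
  obtain ⟨m, rfl⟩ := Nat.exists_eq_add_of_le hn
  rw [show v ^ (N + 1 + m) * x = v * v ^ m * (v ^ N * x) by ring, map_mul, map_mul, map_pow]
  calc _ ≤ V.valuation v * 1 * 1 := by
        gcongr
        exact pow_le_one₀ zero_le hv.le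
    _ < 1 := by simpa using hv

open scoped IntermediateField.algebraAdjoinAdjoin in
lemma li_of_poly {ι : Type*} [Finite ι] (s : F) (u : ι → F)
    (h : ∀ c : ι → k[X], ∑ᶠ i, aeval s (c i) * u i = 0 → ∀ i, aeval s (c i) = 0) :
    LinearIndependent k⟮s⟯ u := by
  classical
  have := Fintype.ofFinite ι
  rw [← LinearIndependent.iff_fractionRing (R := Algebra.adjoin k {s}), Fintype.linearIndependent_iff]
  intro g hg i
  have : ∀ i, ∃ c : k[X], aeval s c = (g i : F) := by
    intro i
    have h2 : ∀ z ∈ Algebra.adjoin k {s}, ∃ c : k[X], aeval s c = z := by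
      intro z hz
      rw [Algebra.adjoin_singleton_eq_range_aeval] at hz
      exact hz
    exact h2 _ (g i).2
  choose c hc using this
  have h1 := h c (by
    rw [finsum_eq_sum_of_fintype, ← hg]
    refine Finset.sum_congr rfl fun i _ => ?_
    rw [hc]; rfl) i
  ext
  rw [← hc, h1]; rfl

lemma rank_bound (htr : Algebra.trdeg k F ≤ 1) (O : Subalgebra k F) [IsLocalRing O]
    (V : ValuationSubring F) (hV : ∀ c : k, algebraMap k F c ∈ V)
    (a : F) (haO : a ∈ O) (haV : a ∉ V)
    (π : O) (hπ : π ∈ IsLocalRing.maximalIdeal O) (hπ0 : (π : F) ≠ 0)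
    (s : F) (hs0 : s ≠ 0) (hsV : V.valuation s < 1) (htrans : Transcendental k s)
    (M : Submodule k F) (hMO : ∀ a ∈ O, ∀ x ∈ M, a * x ∈ M) (hMs : ∀ x ∈ M, s * x ∈ M)
    (hMJ : ∀ x, ∃ J : ℕ, s ^ J * x ∈ M)
    [FiniteDimensional k⟮s⟯ F] {ι : Type*} [Fintype ι] (u : ι → F) (hu : ∀ i, u i ∈ M)
    (hind : ∀ c : ι → k, s⁻¹ * ∑ i, c i • u i ∈ M → ∀ i, c i = 0) :
    Fintype.card ι + 1 ≤ Module.finrank k⟮s⟯ F := by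
  classical
  -- an element of m_O outside V
  have ha0 : a ≠ 0 := by rintro rfl; exact haV V.zero_mem
  have hainv : V.valuation a⁻¹ < 1 := by
    rw [map_inv₀]
    have : 1 < V.valuation a := by
      rw [← not_le, V.valuation_le_one_iff]; exact haV
    exact inv_lt_one_of_one_lt₀ this
  obtain ⟨N, hN⟩ := V_arch htr V hV a⁻¹ hainv (π : F)⁻¹
  have hN := hN N le_rfl
  let a' : O := ⟨a, haO⟩ ^ N * π
  have ha'm : a' ∈ IsLocalRing.maximalIdeal O := Ideal.mul_mem_left _ _ hπ
  have ha'V : 1 < V.valuation (a' : F) := by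
    have h1 : (a' : F) = (a⁻¹ ^ N * (π : F)⁻¹)⁻¹ := by simp [a', mul_comm]
    rw [h1, map_inv₀, one_lt_inv₀ (by
      rw [zero_lt_iff]; simp [ha0, hπ0])]
    exact hN
  have hunit : IsUnit (1 + a') := by
    by_contra hnu
    have := Ideal.sub_mem _ ((IsLocalRing.mem_maximalIdeal _).2 hnu) ha'm
    simp only [add_sub_cancel_right] at this
    exact this isUnit_one
  obtain ⟨e, he⟩ := hunit
  set x : F := (((e⁻¹ : Oˣ) : O) : F) with hx
  set y : F := ((e : O) : F) with hy
  have hxy : x * y = 1 := by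
    have : ((e⁻¹ : Oˣ) : O) * (e : O) = 1 := by simp
    exact congrArg Subtype.val this
  have hx0 : x ≠ 0 := left_ne_zero_of_mul_eq_one hxy
  have hy0 : y ≠ 0 := right_ne_zero_of_mul_eq_one hxy
  have hxV : V.valuation x < 1 := by
    have h1 : x = y⁻¹ := eq_inv_of_mul_eq_one_left hxy
    have h2 : y = 1 + a' := congrArg Subtype.val he
    rw [h1, map_inv₀, h2, add_comm, V.valuation.map_add_eq_of_lt_left (by simpa using ha'V)]
    exact inv_lt_one_of_one_lt₀ ha'V
  have hxO : x ∈ O := ((e⁻¹ : Oˣ) : O).2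
  have hyO : y ∈ O := (e : O).2
  -- replace u
  have : ∃ P : ℕ, ∀ i, V.valuation (x ^ P * u i) < 1 := by
    choose P hP using fun i => V_arch htr V hV x hxV (u i)
    exact ⟨Finset.univ.sup P, fun i => hP i _ (Finset.le_sup (Finset.mem_univ i))⟩
  obtain ⟨P, hP⟩ := this
  obtain ⟨J, hJ⟩ := hMJ 1
  obtain ⟨l, hl⟩ := V_arch htr V hV x hxV (s⁻¹ ^ (J + 1))
  have hl := hl l le_rfl
  let u' : ι → F := fun i => x ^ P * u i
  have hu'M : ∀ i, u' i ∈ M := fun i => hMO _ (O.pow_mem hxO _) _ (hu i)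
  let u0 : F := s ^ (J + 1) * y ^ l
  have hu00 : u0 ≠ 0 := by simp [u0, hs0, hy0]
  have hu0M : s⁻¹ * u0 ∈ M := by
    have : s⁻¹ * u0 = y ^ l * (s ^ J * 1) := by
      simp only [u0]; field_simp; ring
    rw [this]
    exact hMO _ (O.pow_mem hyO _) _ hJ
  have hu0V : V.valuation u0⁻¹ < 1 := by
    have : u0⁻¹ = x ^ l * s⁻¹ ^ (J + 1) := by
      rw [eq_inv_of_mul_eq_one_left hxy]; simp [u0, mul_comm]
    rw [this]; exact hl
  have hpM : ∀ (q : k[X]), ∀ z ∈ M, aeval s q * z ∈ M := by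
    intro q z hz
    induction q using Polynomial.induction_on' with
    | add p q hp hq => rw [map_add, add_mul]; exact M.add_mem hp hq
    | monomial n c =>
      rw [aeval_monomial, mul_assoc, ← Algebra.smul_def]
      refine M.smul_mem _ ?_
      induction n with
      | zero => simpa using hz
      | succ n ih => rw [pow_succ', mul_assoc]; exact hMs _ ih
  have hpV : ∀ (q : k[X]), V.valuation (aeval s q) ≤ 1 := by
    intro q
    rw [V.valuation_le_one_iff]
    have : aeval s q ∈ vsAlg V hV := by
      have h1 := aeval_mem_adjoin_singleton k s (p := q)
      refine (Algebra.adjoin_le ?_ : _ ≤ vsAlg V hV) h1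
      simpa [mem_vsAlg] using (V.valuation_le_one_iff s).1 hsV.le
    exact this
  have hdecomp : ∀ q : k[X], aeval s q = s * aeval s q.divX + algebraMap k F (q.coeff 0) := by
    intro q
    have := congrArg (aeval s) (divX_mul_X_add q)
    simp only [map_add, map_mul, aeval_X, aeval_C] at this
    rw [← this, mul_comm]
  -- one step
  have step : ∀ (c0 : k[X]) (c : ι → k[X]),
      aeval s c0 * u0 + ∑ i, aeval s (c i) * u' i = 0 → c0.coeff 0 = 0 ∧ ∀ i, (c i).coeff 0 = 0 := by
    intro c0 c h
    have hi : ∀ i, (c i).coeff 0 = 0 := by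
      apply hind
      have h2 : s⁻¹ * ∑ i, (c i).coeff 0 • u' i ∈ M := by
        have : s⁻¹ * ∑ i, (c i).coeff 0 • u' i =
            - (aeval s c0 * (s⁻¹ * u0)) - ∑ i, aeval s (c i).divX * u' i := by
          have h3 : ∑ i, aeval s (c i) * u' i =
              s * ∑ i, aeval s (c i).divX * u' i + ∑ i, (c i).coeff 0 • u' i := by
            rw [Finset.mul_sum, ← Finset.sum_add_distrib]
            refine Finset.sum_congr rfl fun i _ => ?_
            rw [hdecomp (c i), Algebra.smul_def]; ring
          rw [h3] at h
          field_simp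
          linear_combination h
        rw [this]
        refine M.sub_mem (M.neg_mem (hpM _ _ hu0M)) (M.sum_mem fun i _ => hpM _ _ (hu'M i))
      have h4 := hMO _ (O.pow_mem hyO P) _ h2
      convert h4 using 1
      rw [mul_left_comm, Finset.mul_sum (a := y ^ P)]
      congr 1
      refine Finset.sum_congr rfl fun i _ => ?_
      simp only [u', Algebra.smul_def]
      rw [mul_left_comm, ← mul_assoc (y ^ P), ← mul_pow, mul_comm y, hxy, one_pow, one_mul]
    refine ⟨?_, hi⟩
    by_contra hne
    have hval : V.valuation (algebraMap k F (c0.coeff 0)) < 1 := by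
      have : algebraMap k F (c0.coeff 0) =
          - (s * aeval s c0.divX + ∑ i, s * aeval s (c i).divX * (u' i) * u0⁻¹) := by
        rw [hdecomp c0] at h
        have h3 : ∑ i, aeval s (c i) * u' i = ∑ i, s * aeval s (c i).divX * u' i := by
          refine Finset.sum_congr rfl fun i _ => ?_
          rw [hdecomp (c i), hi i]; simp
        rw [h3] at h
        rw [← Finset.sum_mul]
        field_simp
        linear_combination h
      rw [this, Valuation.map_neg]
      refine V.valuation.map_add_lt ?_ (V.valuation.map_sum_lt one_ne_zero fun i _ => ?_)
      · rw [map_mul]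
        calc _ ≤ V.valuation s * 1 := by gcongr; exact hpV _
          _ < 1 := by simpa using hsV
      · simp only [map_mul]
        calc _ ≤ V.valuation s * 1 * 1 * 1 := by
              gcongr
              · exact hpV _
              · exact (hP i).le
          _ < 1 := by simpa using hsV
    have h5 : (V.valuation (algebraMap k F (c0.coeff 0)))⁻¹ ≤ 1 := by
      rw [← map_inv₀, ← map_inv₀, V.valuation_le_one_iff]
      exact hV _
    have h6 : V.valuation (algebraMap k F (c0.coeff 0)) ≠ 0 := by simpa using hne
    have := (inv_le_one₀ (zero_lt_iff.2 h6)).1 h5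
    exact absurd hval (not_lt.2 this)
  have steps : ∀ n : ℕ, ∀ (c0 : k[X]) (c : ι → k[X]),
      aeval s c0 * u0 + ∑ i, aeval s (c i) * u' i = 0 → c0.coeff n = 0 ∧ ∀ i, (c i).coeff n = 0 := by
    intro n
    induction n with
    | zero => exact step
    | succ n ih =>
      intro c0 c h
      obtain ⟨h1, h2⟩ := step c0 c h
      have := ih c0.divX (fun i => (c i).divX) (by
        have : s * (aeval s c0.divX * u0 + ∑ i, aeval s (c i).divX * u' i) = 0 := by
          rw [← h, mul_add, Finset.mul_sum, hdecomp c0, h1]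
          simp only [map_zero, add_zero, mul_assoc]
          congr 1
          refine Finset.sum_congr rfl fun i _ => ?_
          rw [hdecomp (c i), h2 i]; simp [mul_assoc]
        exact (mul_eq_zero.1 this).resolve_left hs0)
      simpa using this
  have hli : LinearIndependent k⟮s⟯ (fun i : Option ι => i.elim u0 u') := by
    apply li_of_poly
    intro c hc
    rw [finsum_eq_sum_of_fintype, Fintype.sum_option] at hc
    simp only [Option.elim] at hc
    have h0 : ∀ i, c i = 0 := by
      intro i
      ext n
      have := steps n (c none) (fun i => c (some i)) hc
      cases i with
      | none => simpa using this.1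
      | some i => simpa using this.2 i
    intro i
    rw [h0 i, map_zero]
  have := hli.fintype_card_le_finrank
  simpa using this
end Core2
end AffCurve
end

section
open Polynomial IntermediateField

namespace AffCurve

section Core3
variable {k F : Type*} [Field k] [Field F] [Algebra k F]

lemma exists_gens (s : F) (M : Submodule k F) (n : ℕ)
    (hb : ∀ (r : ℕ) (u : Fin r → F), (∀ i, u i ∈ M) →
      (∀ c : Fin r → k, s⁻¹ * ∑ i, c i • u i ∈ M → ∀ i, c i = 0) → r + 1 ≤ n) :
    ∃ (r : ℕ) (u : Fin r → F), r + 1 ≤ n ∧ (∀ i, u i ∈ M) ∧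
      ∀ x ∈ M, ∃ c : Fin r → k, s⁻¹ * (x - ∑ i, c i • u i) ∈ M := by
  classical
  let P : ℕ → Prop := fun r => ∃ u : Fin r → F, (∀ i, u i ∈ M) ∧
      (∀ c : Fin r → k, s⁻¹ * ∑ i, c i • u i ∈ M → ∀ i, c i = 0)
  have hP0 : P 0 := ⟨Fin.elim0, fun i => i.elim0, fun _ _ i => i.elim0⟩
  obtain ⟨r, hr⟩ : ∃ r, r = Nat.findGreatest P n := ⟨_, rfl⟩
  have hPr : P r := by rw [hr]; exact Nat.findGreatest_spec (P := P) (Nat.zero_le n) hP0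
  obtain ⟨u, hu, hind⟩ := hPr
  refine ⟨r, u, hb r u hu hind, hu, fun x hx => ?_⟩
  by_contra! hcon
  have hP1 : P (r + 1) := by
    refine ⟨Fin.cons x u, ?_, ?_⟩
    · intro i
      refine Fin.cases ?_ ?_ i
      · simpa using hx
      · intro i; simpa using hu i
    · intro c hc
      rw [Fin.sum_univ_succ] at hc
      simp only [Fin.cons_zero, Fin.cons_succ] at hc
      have h0 : c 0 = 0 := by
        by_contra hne
        apply hcon (fun i => - (c 0)⁻¹ * c i.succ)
        have := M.smul_mem (c 0)⁻¹ hc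
        convert this using 1
        rw [← mul_smul_comm, smul_add, smul_smul, inv_mul_cancel₀ hne, one_smul, sub_eq_add_neg,
          ← Finset.sum_neg_distrib, Finset.smul_sum]
        congr 2
        refine Finset.sum_congr rfl fun i _ => ?_
        rw [smul_smul, neg_mul, neg_smul, neg_neg]
      intro i
      refine Fin.cases h0 ?_ i
      apply hind
      rw [h0] at hc
      simpa using hc
  obtain ⟨u1, hu1, hind1⟩ := id hP1
  have := Nat.le_findGreatest (P := P) (show r + 1 ≤ n by have := hb _ u1 hu1 hind1; omega) hP1
  omega

lemma exists_gens_pow (s : F) (hs0 : s ≠ 0) (M : Submodule k F) {r : ℕ} (u : Fin r → F)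
    (hgen : ∀ x ∈ M, ∃ c : Fin r → k, s⁻¹ * (x - ∑ i, c i • u i) ∈ M) (l : ℕ) :
    ∀ x ∈ M, ∃ c : Fin l → Fin r → k,
      s⁻¹ ^ l * (x - ∑ e : Fin l, ∑ i, c e i • (s ^ (e : ℕ) * u i)) ∈ M := by
  induction l with
  | zero => intro x hx; exact ⟨Fin.elim0, by simpa using hx⟩
  | succ l ih =>
    intro x hx
    obtain ⟨c, hc⟩ := ih x hx
    obtain ⟨d, hd⟩ := hgen _ hc
    refine ⟨Fin.snoc (α := fun _ => Fin r → k) c d, ?_⟩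
    rw [Fin.sum_univ_castSucc]
    simp only [Fin.snoc_castSucc, Fin.snoc_last, Fin.val_castSucc, Fin.val_last]
    convert hd using 1
    rw [pow_succ', mul_assoc]
    congr 1
    rw [← sub_sub, mul_sub]
    congr 1
    rw [Finset.mul_sum]
    refine Finset.sum_congr rfl fun i _ => ?_
    rw [mul_smul_comm, ← mul_assoc, ← mul_pow, inv_mul_cancel₀ hs0, one_pow, one_mul]

lemma count (s : F) (hs0 : s ≠ 0) (htrans : Transcendental k s) (M : Submodule k F)
    (n : ℕ) (hb : ∀ (r : ℕ) (u : Fin r → F), (∀ i, u i ∈ M) →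
      (∀ c : Fin r → k, s⁻¹ * ∑ i, c i • u i ∈ M → ∀ i, c i = 0) → r + 1 ≤ n)
    (A : Subalgebra k F) (htA : s⁻¹ ∈ A) (y : Fin n → F) (hyA : ∀ i, y i ∈ A)
    (hy : LinearIndependent k⟮s⟯ y) (hMs : ∀ x ∈ M, s * x ∈ M)
    (hMJ : ∀ x, ∃ J : ℕ, s ^ J * x ∈ M) :
    ∃ g ∈ A, g ≠ 0 ∧ s⁻¹ * g ∈ M := by
  classical
  obtain ⟨r, u, hrn, hu, hgen⟩ := exists_gens s M n hb
  have hMpow : ∀ (e : ℕ), ∀ x ∈ M, s ^ e * x ∈ M := by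
    intro e x hx
    induction e with
    | zero => simpa using hx
    | succ e ih => rw [pow_succ', mul_assoc]; exact hMs _ ih
  have : ∃ c : ℕ, ∀ c' ≥ c, ∀ i, s ^ c' * y i ∈ M := by
    choose J hJ using hMJ
    refine ⟨Finset.univ.sup (fun i => J (y i)), fun c' hc' i => ?_⟩
    have h1 : J (y i) ≤ c' :=
      (Finset.le_sup (f := fun i => J (y i)) (Finset.mem_univ i)).trans hc'
    rw [← Nat.sub_add_cancel h1, pow_add, mul_assoc]
    exact hMpow _ _ (hJ _)
  obtain ⟨c, hc⟩ := this
  let m := c * n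
  let l := m + c + 1
  choose lam hlam using exists_gens_pow s hs0 M u hgen l
  let z : Fin n × Fin (m + 1) → F := fun p => s ^ (c + (p.2 : ℕ)) * y p.1
  have hz : ∀ p, z p ∈ M := fun p => hc _ (by omega) _
  let φ : (Fin n × Fin (m + 1) → k) →ₗ[k] (Fin l → Fin r → k) :=
    Fintype.linearCombination k (fun p => lam (z p) (hz p))
  have hker : LinearMap.ker φ ≠ ⊥ := by
    apply LinearMap.ker_ne_bot_of_finrank_lt
    simp only [Module.finrank_pi, Module.finrank_pi_fintype, Fintype.card_prod, Fintype.card_fin,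
      Finset.sum_const, Finset.card_univ, smul_eq_mul]
    have h1 : r ≤ n - 1 := by omega
    obtain ⟨n', rfl⟩ : ∃ n', n = n' + 1 := ⟨n - 1, by omega⟩
    simp only [Nat.add_sub_cancel] at h1
    calc l * r ≤ l * n' := Nat.mul_le_mul_left _ h1
      _ < _ := by simp only [l, m]; nlinarith
  obtain ⟨κ, hκ, hκ0⟩ := (Submodule.ne_bot_iff _).1 hker
  let g' : F := ∑ p, κ p • z p
  have hg'M : s⁻¹ ^ l * g' ∈ M := by
    have h1 : s⁻¹ ^ l * g' = ∑ p, κ p • (s⁻¹ ^ l * (z p -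
        ∑ e : Fin l, ∑ i, lam (z p) (hz p) e i • (s ^ (e : ℕ) * u i))) := by
      have h2 : ∑ p, κ p • (∑ e : Fin l, ∑ i, lam (z p) (hz p) e i • (s ^ (e : ℕ) * u i)) = 0 := by
        have h3 : ∀ e i, ∑ p, κ p * lam (z p) (hz p) e i = 0 := by
          intro e i
          have := congrFun (congrFun (LinearMap.mem_ker.1 hκ) e) i
          simpa [φ, Fintype.linearCombination_apply] using this
        simp only [Finset.smul_sum, smul_smul]
        rw [Finset.sum_comm]
        refine Finset.sum_eq_zero fun e _ => ?_
        rw [Finset.sum_comm]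
        refine Finset.sum_eq_zero fun i _ => ?_
        rw [← Finset.sum_smul, h3, zero_smul]
      have h4 : ∀ p, κ p • (s⁻¹ ^ l * (z p -
          ∑ e : Fin l, ∑ i, lam (z p) (hz p) e i • (s ^ (e : ℕ) * u i))) = s⁻¹ ^ l * (κ p • z p -
          κ p • ∑ e : Fin l, ∑ i, lam (z p) (hz p) e i • (s ^ (e : ℕ) * u i)) := fun p => by
        rw [← smul_sub, mul_smul_comm]
      simp only [h4]
      rw [← Finset.mul_sum, Finset.sum_sub_distrib, h2, sub_zero]
    rw [h1]
    exact M.sum_mem fun p _ => M.smul_mem _ (hlam _ _)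
  have hg'0 : g' ≠ 0 := by
    intro h0
    apply hκ0
    let Q : Fin n → k[X] := fun i => ∑ e : Fin (m + 1), C (κ (i, e)) * X ^ (c + (e : ℕ))
    let sE : k⟮s⟯ := IntermediateField.AdjoinSimple.gen k s
    have h1 : ∑ i, (aeval sE (Q i)) • y i = 0 := by
      rw [← h0]
      simp only [g']
      rw [Fintype.sum_prod_type]
      refine Finset.sum_congr rfl fun i _ => ?_
      simp only [Q, map_sum, map_mul, aeval_C, map_pow, aeval_X, Finset.sum_smul]
      refine Finset.sum_congr rfl fun e _ => ?_
      simp only [z]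
      rw [Algebra.smul_def, Algebra.smul_def, ← mul_assoc]
      congr 1
    have h2 := Fintype.linearIndependent_iff.1 hy _ h1
    have h3 : ∀ i, Q i = 0 := by
      intro i
      apply transcendental_iff.1 htrans
      have := congrArg (algebraMap k⟮s⟯ F) (h2 i)
      rw [← aeval_algebraMap_apply, map_zero] at this
      exact this
    funext ⟨i, e⟩
    have h4 := congrArg (fun q => coeff q (c + (e : ℕ))) (h3 i)
    simp only [Q, finsetSum_coeff, coeff_C_mul, coeff_X_pow, coeff_zero] at h4
    rw [Finset.sum_eq_single e] at h4
    · simpa using h4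
    · intro b _ hb
      rw [if_neg, mul_zero]
      intro h; apply hb; ext; omega
    · simp
  refine ⟨s⁻¹ ^ (m + c) * g', ?_, by simp [hs0, hg'0], ?_⟩
  · simp only [g']
    rw [Finset.mul_sum]
    refine Subalgebra.sum_mem _ fun p _ => ?_
    rw [mul_smul_comm]
    refine Subalgebra.smul_mem _ ?_ _
    have : s⁻¹ ^ (m + c) * z p = s⁻¹ ^ (m - (p.2 : ℕ)) * y p.1 := by
      have h5 : (p.2 : ℕ) ≤ m := by have := p.2.2; omega
      simp only [z]
      rw [show m + c = (m - p.2) + (c + p.2) by omega, pow_add, mul_assoc,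
        ← mul_assoc (s⁻¹ ^ (c + (p.2 : ℕ))),
        ← mul_pow s⁻¹ s, inv_mul_cancel₀ hs0, one_pow, one_mul]
    rw [this]
    exact A.mul_mem (A.pow_mem htA _) (hyA _)
  · rw [← mul_assoc, ← pow_succ']
    exact hg'M

end Core3
end AffCurve
end

section
open Polynomial IntermediateField

namespace AffCurve

section Core4
variable {k F : Type*} [Field k] [Field F] [Algebra k F]

lemma integralElem_of_comp {R S T : Type*} [CommRing R] [CommRing S] [CommRing T]
    (φ : R →+* T) (ψ : S →+* T) (χ : R →+* S) (h : φ = ψ.comp χ) {x : T}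
    (hx : φ.IsIntegralElem x) : ψ.IsIntegralElem x := by
  obtain ⟨p, hp, hpx⟩ := hx
  refine ⟨p.map χ, hp.map χ, ?_⟩
  rw [eval₂_map, ← h]; exact hpx

lemma mem_of_integralElem {R : Type*} [CommRing R] (φ : R →+* F) (V : ValuationSubring F)
    (h : ∀ r, φ r ∈ V) {x : F} (hx : φ.IsIntegralElem x) : x ∈ V := by
  let χ : R →+* V := φ.codRestrict V.toSubring h
  have h1 : IsIntegral V x := integralElem_of_comp φ (algebraMap V F) χ (by ext; rfl) hx
  obtain ⟨y, hy⟩ := IsIntegrallyClosed.isIntegral_iff.1 h1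
  rw [← hy]; exact y.2

lemma val_of_hom {R : Type*} [CommRing R] (φ : R →+* F) (I : Ideal R)
    (hI : ∀ x ∈ I, φ x ≠ 1) :
    ∃ W : ValuationSubring F, (∀ r, φ r ∈ W) ∧ ∀ x ∈ I, W.valuation (φ x) < 1 := by
  obtain ⟨W, hW, hW'⟩ := Ideal.image_subset_nonunits_valuationSubring (A := φ.range)
    (I.map φ.rangeRestrict) (by
      intro htop
      have h1 : (1 : φ.range) ∈ I.map φ.rangeRestrict := by rw [htop]; trivial
      rw [Ideal.mem_map_iff_of_surjective _ φ.rangeRestrict_surjective] at h1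
      obtain ⟨x, hx, hx1⟩ := h1
      exact hI x hx (congrArg Subtype.val hx1))
  refine ⟨W, fun r => hW ⟨r, rfl⟩, fun x hx => ?_⟩
  have := hW' ⟨φ.rangeRestrict x, Ideal.mem_map_of_mem _ hx, rfl⟩
  exact W.mem_nonunits_iff.1 this

lemma noether (htr : Algebra.trdeg k F ≤ 1) (A : Subalgebra k F) (hA : A.FG)
    (V : ValuationSubring F) (hV : ∀ c : k, algebraMap k F c ∈ V) (hAV : ∃ x ∈ A, x ∉ V) :
    ∃ t ∈ A, t ∉ V ∧ ∀ x ∈ A, ((aeval t : k[X] →ₐ[k] F) : k[X] →+* F).IsIntegralElem x := by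
  have : Algebra.FiniteType k A := (Subalgebra.fg_iff_finiteType A).1 hA
  obtain ⟨n, g, hinj, hintg⟩ := exists_integral_inj_algHom_of_fg k A
  let φ : MvPolynomial (Fin n) k →ₐ[k] F := A.val.comp g
  have hφint : ∀ x ∈ A, (φ : MvPolynomial (Fin n) k →+* F).IsIntegralElem x := by
    intro x hx
    obtain ⟨p, hp, hpx⟩ := hintg ⟨x, hx⟩
    refine ⟨p, hp, ?_⟩
    have := congrArg A.val hpx
    rw [map_zero] at this
    rw [← this]
    exact (Polynomial.hom_eval₂ p g.toRingHom (A.val : A →+* F) ⟨x, hx⟩).symm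
  have hX : ∃ i, φ (MvPolynomial.X i) ∉ V := by
    by_contra! hcon
    obtain ⟨x, hx, hxV⟩ := hAV
    apply hxV
    refine mem_of_integralElem _ V (fun r => ?_) (hφint x hx)
    have h1 : φ.range ≤ vsAlg V hV := by
      rw [← Algebra.map_top, ← MvPolynomial.adjoin_range_X, AlgHom.map_adjoin]
      apply Algebra.adjoin_le
      rintro _ ⟨_, ⟨i, rfl⟩, rfl⟩
      exact hcon i
    exact h1 ⟨r, rfl⟩
  obtain ⟨i, hi⟩ := hX
  have hind : AlgebraicIndependent k (fun i => φ (MvPolynomial.X i)) := by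
    have : (MvPolynomial.aeval (fun i => φ (MvPolynomial.X i)) : MvPolynomial (Fin n) k →ₐ[k] F)
        = φ := by ext; simp
    rw [AlgebraicIndependent, this]
    exact Subtype.val_injective.comp hinj
  have hn : n ≤ 1 := by
    have h2 := hind.lift_cardinalMk_le_trdeg
    have h3 := h2.trans (Cardinal.lift_le.2 htr)
    simpa using h3
  have hsub : ∀ i', i' = i := by
    intro i'; have := i.2; have := i'.2; ext; omega
  refine ⟨φ (MvPolynomial.X i), (g (MvPolynomial.X i)).2, hi, fun x hx => ?_⟩
  refine integralElem_of_comp _ _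
    ((MvPolynomial.aeval (fun _ => X) : MvPolynomial (Fin n) k →ₐ[k] k[X]) :
      MvPolynomial (Fin n) k →+* k[X]) ?_ (hφint x hx)
  have : φ = (aeval (φ (MvPolynomial.X i))).comp
      (MvPolynomial.aeval (fun _ => X) : MvPolynomial (Fin n) k →ₐ[k] k[X]) := by
    ext i'
    rw [hsub i']; simp
  exact congrArg (fun ψ : MvPolynomial (Fin n) k →ₐ[k] F => (ψ : MvPolynomial (Fin n) k →+* F)) this

lemma exists_poly_one (A O : Subalgebra k F) [IsLocalRing O]
    (hsep : ∀ W : ValuationSubring F, (∀ x ∈ A, x ∈ W) → (∀ x ∈ O, x ∈ W) →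
      (∀ x : O, x ∈ IsLocalRing.maximalIdeal O → W.valuation (x : F) < 1) → False)
    (t : F) (ht : ∀ x ∈ A, ((aeval t : k[X] →ₐ[k] F) : k[X] →+* F).IsIntegralElem x) :
    ∃ p : O[X], (∀ n, p.coeff n ∈ IsLocalRing.maximalIdeal O) ∧ aeval t p = 1 := by
  by_contra! hcon
  obtain ⟨W, hW, hW'⟩ := val_of_hom ((aeval t : O[X] →ₐ[O] F) : O[X] →+* F)
    ((IsLocalRing.maximalIdeal O).map C) (fun p hp => hcon p (Ideal.mem_map_C_iff.1 hp))
  have hOW : ∀ x ∈ O, x ∈ W := by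
    intro x hx
    have := hW (C ⟨x, hx⟩)
    simp only [RingHom.coe_coe, aeval_C] at this
    exact this
  refine hsep W (fun x hx => ?_) hOW (fun x hx => ?_)
  · refine mem_of_integralElem _ W (fun q => ?_) (ht x hx)
    have htW : t ∈ W := by simpa using hW X
    have : aeval t q ∈ vsAlg W (fun c => hOW _ (O.algebraMap_mem c)) := by
      have h1 := aeval_mem_adjoin_singleton k t (p := q)
      refine (Algebra.adjoin_le ?_ : _ ≤ vsAlg W _) h1
      simpa [mem_vsAlg] using htW
    exact this
  · have := hW' (C x) (Ideal.mem_map_of_mem _ hx)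
    simp only [RingHom.coe_coe, aeval_C] at this
    exact this

lemma finDim (A : Subalgebra k F) (hA : A.FG) [IsFractionRing A F] (E : IntermediateField k F)
    (t : F) (htE : t ∈ E)
    (ht : ∀ x ∈ A, ((aeval t : k[X] →ₐ[k] F) : k[X] →+* F).IsIntegralElem x) :
    FiniteDimensional E F := by
  obtain ⟨S, hS⟩ := hA
  have hintg : ∀ x ∈ A, IsIntegral E x := by
    intro x hx
    refine integralElem_of_comp _ (algebraMap E F)
      ((aeval (⟨t, htE⟩ : E) : k[X] →ₐ[k] E) : k[X] →+* E) ?_ (ht x hx)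
    have : (aeval t : k[X] →ₐ[k] F) = E.val.comp (aeval (⟨t, htE⟩ : E)) := by
      ext; simp
    exact congrArg (fun ψ : k[X] →ₐ[k] F => (ψ : k[X] →+* F)) this
  have h1 : FiniteDimensional E (IntermediateField.adjoin E (S : Set F)) :=
    IntermediateField.finiteDimensional_adjoin fun x hx => hintg x (by
      rw [← hS]; exact Algebra.subset_adjoin hx)
  have hAle : ∀ x ∈ A, x ∈ IntermediateField.adjoin E (S : Set F) := by
    intro x hx
    rw [← hS] at hx
    have h2 : Algebra.adjoin k (S : Set F) ≤
        ((IntermediateField.adjoin E (S : Set F)).toSubalgebra.restrictScalars k) := by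
      apply Algebra.adjoin_le
      exact IntermediateField.subset_adjoin E _
    exact h2 hx
  have htop : IntermediateField.adjoin E (S : Set F) = ⊤ := by
    rw [eq_top_iff]
    rintro x -
    obtain ⟨a, d, -, rfl⟩ := IsFractionRing.div_surjective (A := A) x
    exact div_mem (hAle _ a.2) (hAle _ d.2)
  rw [htop] at h1
  exact (IntermediateField.topEquiv (F := E) (E := F)).toLinearEquiv.finiteDimensional

lemma exists_li (A : Subalgebra k F) [IsFractionRing A F] (E : IntermediateField k F)
    [FiniteDimensional E F] :
    ∃ y : Fin (Module.finrank E F) → F, (∀ i, y i ∈ A) ∧ LinearIndependent E y := by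
  classical
  let b := Module.finBasis E F
  obtain ⟨d, hd⟩ := IsLocalization.exist_integer_multiples_of_finset (nonZeroDivisors A)
    (Finset.univ.image b)
  have hd0 : ((d : A) : F) ≠ 0 := by
    simp
  refine ⟨fun i => ((d : A) : F) * b i, fun i => ?_, ?_⟩
  · obtain ⟨z, hz⟩ := hd (b i) (by simp)
    have : ((d : A) : F) * b i = z := by
      rw [Algebra.smul_def] at hz; exact hz.symm
    change ((d : A) : F) * b i ∈ A
    rw [this]; exact z.2
  · have h1 := b.linearIndependent.map' (LinearMap.mulLeft E ((d : A) : F)) (by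
      rw [LinearMap.ker_eq_bot]
      exact mul_right_injective₀ hd0)
    exact h1

lemma stepI (htr : Algebra.trdeg k F ≤ 1) (A O : Subalgebra k F) (hA : A.FG)
    [IsFractionRing A F] [IsLocalRing O] [IsFractionRing O F]
    (V : ValuationSubring F) (hV : ∀ c : k, algebraMap k F c ∈ V)
    (hOV : ∃ x ∈ O, x ∉ V) (t : F) (htA : t ∈ A) (htV : t ∉ V)
    (ht : ∀ x ∈ A, ((aeval t : k[X] →ₐ[k] F) : k[X] →+* F).IsIntegralElem x)
    (p : O[X]) (hp : ∀ n, p.coeff n ∈ IsLocalRing.maximalIdeal O) (hpt : aeval t p = 1) :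
    ∃ g : O, g ∈ IsLocalRing.maximalIdeal O ∧ (g : F) ≠ 0 ∧ (g : F) ∈ A := by
  have ht0 : t ≠ 0 := by rintro rfl; exact htV V.zero_mem
  have htO : t ∉ O := by
    intro htO
    have h1 : aeval (⟨t, htO⟩ : O) p = 1 := by
      apply Subtype.ext
      have := aeval_algebraMap_apply F (⟨t, htO⟩ : O) p
      exact this.symm.trans hpt
    have h2 : aeval (⟨t, htO⟩ : O) p ∈ IsLocalRing.maximalIdeal O := by
      rw [aeval_eq_sum_range]
      exact Ideal.sum_mem _ fun i _ => by
        rw [smul_eq_mul]; exact Ideal.mul_mem_right _ _ (hp i)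
    rw [h1] at h2
    exact h2 isUnit_one
  set s := t⁻¹ with hs
  have hs0 : s ≠ 0 := inv_ne_zero ht0
  have hst : s⁻¹ = t := inv_inv t
  have hsV : V.valuation s < 1 := by
    rw [hs, map_inv₀]
    have : 1 < V.valuation t := by
      rw [← not_le, V.valuation_le_one_iff]; exact htV
    exact inv_lt_one_of_one_lt₀ this
  have htrans : Transcendental k s := by
    intro halg
    apply htV
    have h1 : IsIntegral k t := by
      rw [← hst]; exact halg.inv.isIntegral
    exact mem_of_integralElem (algebraMap k F) V hV h1
  let M : Submodule k F :=
    { carrier := {x | ∀ j : ℕ, s ^ j * x ∈ O}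
      add_mem' := fun ha hb j => by rw [mul_add]; exact O.add_mem (ha j) (hb j)
      zero_mem' := fun j => by rw [mul_zero]; exact O.zero_mem
      smul_mem' := fun c x hx j => by rw [mul_smul_comm]; exact O.smul_mem (hx j) c }
  have hM : ∀ x, x ∈ M ↔ ∀ j : ℕ, s ^ j * x ∈ O := fun x => Iff.rfl
  have hMO : ∀ a ∈ O, ∀ x ∈ M, a * x ∈ M := by
    intro a ha x hx j
    rw [mul_left_comm]; exact O.mul_mem ha (hx j)
  have hMs : ∀ x ∈ M, s * x ∈ M := by
    intro x hx j
    rw [← mul_assoc, ← pow_succ]; exact hx _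
  have hMJ : ∀ x, ∃ J : ℕ, s ^ J * x ∈ M := by
    intro x
    obtain ⟨J, hJ⟩ := eventually_mem htr O t ht0 p hp hpt x
    refine ⟨J, fun j => ?_⟩
    rw [← mul_assoc, ← pow_add]
    exact hJ _ (by omega)
  have hπ : ∃ π : O, π ∈ IsLocalRing.maximalIdeal O ∧ (π : F) ≠ 0 := by
    by_contra! hcon
    have : p = 0 := by
      ext n
      simpa using hcon _ (hp n)
    rw [this, map_zero] at hpt
    exact zero_ne_one hpt
  obtain ⟨π, hπ, hπ0⟩ := hπ
  obtain ⟨a, haO, haV⟩ := hOV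
  have htE : t ∈ k⟮s⟯ := by
    rw [← hst]
    exact inv_mem (IntermediateField.mem_adjoin_simple_self k s)
  have := finDim A hA k⟮s⟯ t htE ht
  obtain ⟨y, hyA, hy⟩ := exists_li A k⟮s⟯
  obtain ⟨g, hgA, hg0, hgM⟩ := count s hs0 htrans M (Module.finrank k⟮s⟯ F) (fun r u hu hind => by
    have := rank_bound htr O V hV a haO haV π hπ hπ0 s hs0 hsV htrans M hMO hMs hMJ u hu hind
    simpa using this) A (by rw [hst]; exact htA) y hyA hy hMs hMJ
  have hgO : g ∈ O := by
    have := hgM 1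
    rwa [pow_one, ← mul_assoc, mul_inv_cancel₀ hs0, one_mul] at this
  refine ⟨⟨g, hgO⟩, ?_, hg0, hgA⟩
  intro hu
  obtain ⟨e, he⟩ := hu.exists_left_inv
  have he' : (e : F) * g = 1 := congrArg Subtype.val he
  apply htO
  have h3 := hgM 0
  rw [pow_zero, one_mul, hst] at h3
  have : t = e * (t * g) := by rw [mul_left_comm, he', mul_one]
  rw [this]
  exact O.mul_mem e.2 h3

end Core4
end AffCurve
end

section
open Polynomial IntermediateField

namespace AffCurve

section Core5
variable {k F : Type*} [Field k] [Field F] [Algebra k F]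

lemma core (htr : Algebra.trdeg k F ≤ 1) (A O : Subalgebra k F) (hA : A.FG)
    [IsFractionRing A F] [IsLocalRing O] [IsFractionRing O F]
    (V : ValuationSubring F) (hV : ∀ c : k, algebraMap k F c ∈ V)
    (hAV : ∃ x ∈ A, x ∉ V) (hOV : ∃ x ∈ O, x ∉ V)
    (hsep : ∀ W : ValuationSubring F, (∀ x ∈ A, x ∈ W) → (∀ x ∈ O, x ∈ W) →
      (∀ x : O, x ∈ IsLocalRing.maximalIdeal O → W.valuation (x : F) < 1) → False)
    (j : F) (hjA : j ∈ A) (hj0 : j ≠ 0) :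
    ∃ a ∈ A, ∃ b : O, b ∈ IsLocalRing.maximalIdeal O ∧ (b : F) = 1 - j * a := by
  obtain ⟨t, htA, htV, ht⟩ := noether htr A hA V hV hAV
  obtain ⟨p, hp, hpt⟩ := exists_poly_one A O hsep t ht
  obtain ⟨g, hgm, hg0, hgA⟩ := stepI htr A O hA V hV hOV t htA htV ht p hp hpt
  have ht0 : t ≠ 0 := by rintro rfl; exact htV V.zero_mem
  -- replace g by a multiple of j
  obtain ⟨G, hGm, hG0, G', hG'A, hGG'⟩ : ∃ G : O, G ∈ IsLocalRing.maximalIdeal O ∧ (G : F) ≠ 0 ∧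
      ∃ G' ∈ A, (G : F) = j * G' := by
    obtain ⟨a, d, hd, hx⟩ := IsFractionRing.div_surjective (A := O) j
    have hd0 : (d : F) ≠ 0 := by
      have := nonZeroDivisors.ne_zero hd
      simpa using this
    obtain ⟨N, w, hN⟩ := arch htr O g hgm hg0 d hd0
    have hN' : (g : F) ^ N = d * w := congrArg Subtype.val hN
    have hw0 : (w : F) ≠ 0 := by
      intro h; rw [h, mul_zero] at hN'; exact pow_ne_zero _ hg0 hN'
    have hx' : (a : F) = j * d := by
      have : (a : F) / d = j := hx
      rw [← this]; field_simp
    refine ⟨g * (w * a), Ideal.mul_mem_right _ _ hgm, ?_, (g : F) ^ (N + 1), A.pow_mem hgA _, ?_⟩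
    · simp [hg0, hw0, hx', hj0, hd0]
    · simp only [MulMemClass.coe_mul]
      rw [pow_succ, hN', hx']; ring
  have hGA : (G : F) ∈ A := by rw [hGG']; exact A.mul_mem hjA hG'A
  obtain ⟨N, hN⟩ := eventually_mem htr O t ht0 p hp hpt ((G : F)⁻¹ * (g : F)⁻¹)
  have hN := hN N le_rfl
  let y : O := g * ⟨_, hN⟩
  have hym : y ∈ IsLocalRing.maximalIdeal O := Ideal.mul_mem_right _ _ hgm
  have hy : (y : F) = t⁻¹ ^ N * (G : F)⁻¹ := by
    simp only [y, MulMemClass.coe_mul]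
    field_simp
  have hy0 : (y : F) ≠ 0 := by rw [hy]; simp [ht0, hG0]
  have hunit : IsUnit (1 + y) := by
    by_contra hnu
    have := Ideal.sub_mem _ ((IsLocalRing.mem_maximalIdeal _).2 hnu) hym
    simp only [add_sub_cancel_right] at this
    exact this isUnit_one
  obtain ⟨e, he⟩ := hunit.exists_left_inv
  have he' : (e : F) * (1 + y) = 1 := congrArg Subtype.val he
  have h1y : (1 + (y : F)) ≠ 0 := right_ne_zero_of_mul_eq_one he'
  let v : F := 1 + G * t ^ N
  have hvA : v ∈ A := A.add_mem A.one_mem (A.mul_mem hGA (A.pow_mem htA _))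
  have hvy : v * y = 1 + y := by
    simp only [v]
    rw [add_mul, hy, inv_pow]
    field_simp
    ring
  have hv0 : v ≠ 0 := left_ne_zero_of_mul (hvy ▸ h1y)
  obtain ⟨c, hc0, w0, hw0, hcw⟩ := exists_dvd_poly htr
    (transcendental_of_mem_maximalIdeal O G hGm hG0) hv0
  have hw0A : w0 ∈ A := by
    refine (Algebra.adjoin_le ?_ : _ ≤ A) hw0
    rintro _ (rfl | rfl)
    · exact hGA
    · exact hvA
  have hcancel : ∀ m : ℕ, ∀ z ∈ A, ∀ w ∈ A, (G : F) ^ m * z = v * w → ∃ w' ∈ A, z = v * w' := by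
    intro m
    induction m with
    | zero => intro z _ w hw h; exact ⟨w, hw, by simpa using h⟩
    | succ m ih =>
      intro z hz w hw h
      refine ih z hz ((G : F) ^ m * z - t ^ N * w) (A.sub_mem (A.mul_mem (A.pow_mem hGA _) hz)
        (A.mul_mem (A.pow_mem htA _) hw)) ?_
      apply mul_left_cancel₀ hG0
      have hv : v = 1 + G * t ^ N := rfl
      have : (G : F) * ((G : F) ^ m * z) = v * w := by rw [← h]; ring
      rw [this, hv, mul_sub, mul_sub]
      rw [hv] at this
      linear_combination (-(1 + (G : F) * t ^ N)) * this
  obtain ⟨c', hc', hnd⟩ := exists_eq_pow_rootMultiplicity_mul_and_not_dvd c hc0 0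
  simp only [map_zero, sub_zero] at hc' hnd
  rw [X_dvd_iff] at hnd
  have haevA : ∀ q : k[X], aeval (G : F) q ∈ A := by
    intro q
    have h1 := aeval_mem_adjoin_singleton k (G : F) (p := q)
    exact (Algebra.adjoin_le (by simpa using hGA) : _ ≤ A) h1
  have haevO : ∀ q : k[X], aeval (G : F) q ∈ O := by
    intro q
    have h1 := aeval_mem_adjoin_singleton k (G : F) (p := q)
    exact (Algebra.adjoin_le (by simp) : _ ≤ O) h1
  obtain ⟨w', hw'A, hw'⟩ := hcancel _ (aeval (G : F) c') (haevA _) w0 hw0A (by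
    rw [← hcw]; conv_rhs => rw [hc']
    rw [map_mul, map_pow, aeval_X])
  let q : k[X] := C (c'.coeff 0)⁻¹ * c'
  have hq0 : q.coeff 0 = 1 := by simp [q, hnd]
  let w : F := algebraMap k F (c'.coeff 0)⁻¹ * w'
  have hwA : w ∈ A := A.mul_mem (A.algebraMap_mem _) hw'A
  have hqw : aeval (G : F) q = v * w := by
    simp only [q, w, map_mul, aeval_C, hw']; ring
  have hqdec : aeval (G : F) q = G * aeval (G : F) q.divX + 1 := by
    have := congrArg (aeval (G : F)) (divX_mul_X_add q)
    simp only [map_add, map_mul, aeval_X, aeval_C, hq0, map_one] at this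
    rw [← this, mul_comm]
  have hw_eq : w = e * y * aeval (G : F) q := by
    apply mul_left_cancel₀ hv0
    rw [← hqw]
    have : v * (e * y * aeval (G : F) q) = (e * (v * y)) * aeval (G : F) q := by ring
    rw [this, hvy, he', one_mul]
  refine ⟨G' * (t ^ N * w - aeval (G : F) q.divX), A.mul_mem hG'A (A.sub_mem
    (A.mul_mem (A.pow_mem htA _) hwA) (haevA _)), y * (e * ⟨_, haevO q⟩),
    Ideal.mul_mem_right _ _ hym, ?_⟩
  rw [← mul_assoc j, ← hGG']
  have h1 : ((y * (e * ⟨_, haevO q⟩) : O) : F) = w := by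
    rw [hw_eq]; simp only [MulMemClass.coe_mul]; ring
  rw [h1]
  have hv : v = 1 + G * t ^ N := rfl
  rw [hqdec, hv] at hqw
  linear_combination -hqw

end Core5
end AffCurve
end

section
open Polynomial

namespace AffCurve

section Curve

lemma height_mvPoly {k : Type*} [Field k] (n : ℕ) (m : Ideal (MvPolynomial (Fin n) k))
    (hm : m.IsMaximal) : (n : ℕ∞) ≤ m.height := by
  induction n with
  | zero => simp
  | succ n ih =>
    let e := (MvPolynomial.finSuccEquiv k n).toRingEquiv
    let P : Ideal (MvPolynomial (Fin n) k)[X] := m.comap e.symm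
    have hP : P.IsMaximal := Ideal.comap_isMaximal_of_equiv e.symm
    have h1 : m.height = P.height := (e.symm.height_comap m).symm
    have hlo : P.LiesOver (P.under (MvPolynomial (Fin n) k)) := ⟨rfl⟩
    have h2 := Polynomial.height_eq_height_add_one (P.under (MvPolynomial (Fin n) k)) P
    have h3 : (P.under (MvPolynomial (Fin n) k)).IsMaximal :=
      Polynomial.isMaximal_comap_C_of_isJacobsonRing P
    rw [h1, h2]
    push_cast
    gcongr
    exact ih _ h3

variable {k B L : Type*} [Field k] [CommRing B] [IsDomain B] [Algebra k B] [Algebra.FiniteType k B]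
  [Field L] [Algebra k L] [Algebra B L] [IsScalarTower k B L] [IsFractionRing B L]

lemma exists_prime_avoid (m : Ideal B) [m.IsMaximal] (hm : 2 ≤ m.height) (β : B)
    [IsNoetherianRing B] (hβ : β ≠ 0) :
    ∃ P : Ideal B, P.IsPrime ∧ P ≠ ⊥ ∧ β ∉ P ∧ P ≤ m := by
  by_cases hβm : β ∈ m
  swap
  · refine ⟨m, inferInstance, ?_, hβm, le_rfl⟩
    intro hm0
    rw [hm0, Ideal.height_bot] at hm
    exact absurd hm (by decide)
  have hfin : (Ideal.span {β}).minimalPrimes.Finite := Ideal.finite_minimalPrimes_of_isNoetherianRing _ _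
  have hc : ∃ c ∈ m, ∀ Q ∈ (Ideal.span {β}).minimalPrimes, c ∉ Q := by
    by_contra! hcon
    have hsub : (m : Set B) ⊆ ⋃ Q ∈ (hfin.toFinset : Set (Ideal B)), (id Q : Ideal B) := by
      intro c hc
      obtain ⟨Q, hQ, hcQ⟩ := hcon c hc
      simp only [Set.mem_iUnion]
      exact ⟨Q, by simpa using hQ, hcQ⟩
    have := (Ideal.subset_union_prime (s := hfin.toFinset) (f := id) ⊥ ⊥ (by
      intro Q hQ _ _
      exact ((hfin.mem_toFinset.1 hQ).1).1) (I := m)).1 hsub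
    obtain ⟨Q, hQ, hmQ⟩ := this
    have hQ' := hfin.mem_toFinset.1 hQ
    have hQp : Q.IsPrime := hQ'.1.1
    have hle : m.height ≤ Q.height := Ideal.height_mono hmQ
    have h1 : Q.height ≤ 1 := Ideal.height_le_one_of_isPrincipal_of_mem_minimalPrimes _ Q hQ'
    exact absurd (hm.trans (hle.trans h1)) (by decide)
  obtain ⟨c, hcm, hc⟩ := hc
  have hc0 : c ≠ 0 := by
    rintro rfl
    obtain ⟨Q, hQ, -⟩ := Ideal.exists_minimalPrimes_le
      (show Ideal.span {β} ≤ m by simpa [Ideal.span_le] using hβm)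
    exact hc Q hQ Q.zero_mem
  have hcle : Ideal.span {c} ≤ m := by simpa [Ideal.span_le] using hcm
  obtain ⟨P, hP, hPm⟩ := Ideal.exists_minimalPrimes_le hcle
  have hPp : P.IsPrime := hP.1.1
  have hcP : c ∈ P := hP.1.2 (Ideal.mem_span_singleton_self c)
  refine ⟨P, hPp, ?_, ?_, hPm⟩
  · rintro rfl; exact hc0 (by simpa using hcP)
  intro hβP
  obtain ⟨Q, hQ, hQP⟩ := Ideal.exists_minimalPrimes_le
    (show Ideal.span {β} ≤ P by simpa [Ideal.span_le] using hβP)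
  have hQp : Q.IsPrime := hQ.1.1
  have hne : Q ≠ P := by rintro rfl; exact hc Q hQ hcP
  have hlt : Q < P := lt_of_le_of_ne hQP hne
  have hQ0 : ⊥ < Q := by
    rw [bot_lt_iff_ne_bot]
    rintro rfl
    have := hQ.1.2 (Ideal.mem_span_singleton_self β)
    exact hβ (by simpa using this)
  have h1 : P.height ≤ 1 := Ideal.height_le_one_of_isPrincipal_of_mem_minimalPrimes _ P hP
  have hbp : (⊥ : Ideal B).IsPrime := Ideal.isPrime_bot
  have h2 := Ideal.height_add_one_le_of_lt_of_isPrime hlt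
  have h3 := Ideal.height_add_one_le_of_lt_of_isPrime hQ0
  have h4 : (2 : ℕ∞) ≤ 1 := by
    calc (2 : ℕ∞) = 0 + 1 + 1 := by norm_num
      _ ≤ (⊥ : Ideal B).height + 1 + 1 := by gcongr; exact zero_le
      _ ≤ 1 := (add_le_add_left h3 1).trans (h2.trans h1)
  exact absurd h4 (by decide)

lemma trdeg_le_one (β : B) (hβ : β ≠ 0) (I : Ideal B) (hI : I ≠ ⊤)
    (h : ∀ P : Ideal B, P.IsPrime → P ≠ ⊥ → β ∉ P → P ⊔ I = ⊤) : Algebra.trdeg k L ≤ 1 := by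
  have hnoeth : IsNoetherianRing B := Algebra.FiniteType.isNoetherianRing k B
  obtain ⟨n, g, hinj, hintg⟩ := exists_integral_inj_algHom_of_fg k B
  have hn : n ≤ 1 := by
    by_contra! hn
    obtain ⟨m, hm, hIm⟩ := Ideal.exists_le_maximal I hI
    let _ := g.toRingHom.toAlgebra
    have : FaithfulSMul (MvPolynomial (Fin n) k) B :=
      (faithfulSMul_iff_algebraMap_injective _ _).2 hinj
    have : Algebra.IsIntegral (MvPolynomial (Fin n) k) B := ⟨hintg⟩
    have hmax : (m.under (MvPolynomial (Fin n) k)).IsMaximal :=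
      Ideal.isMaximal_comap_of_isIntegral_of_isMaximal m
    have h1 := Ideal.height_eq_height_add_of_liesOver_of_hasGoingDown
      (m.under (MvPolynomial (Fin n) k)) m
    have h2 : 2 ≤ m.height := by
      rw [h1]
      refine le_trans ?_ le_self_add
      refine le_trans ?_ (height_mvPoly n _ hmax)
      exact_mod_cast hn
    obtain ⟨P, hP, hP0, hβP, hPm⟩ := exists_prime_avoid m h2 β hβ
    have h3 := h P hP hP0 hβP
    exact hm.ne_top (top_le_iff.1 (h3 ▸ sup_le hPm hIm))
  let s : Set L := Set.range (fun i : Fin n => algebraMap B L (g (MvPolynomial.X i)))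
  have halg : Algebra.IsAlgebraic (Algebra.adjoin k s) L := by
    have hB : ∀ b : B, IsIntegral (Algebra.adjoin k s) (algebraMap B L b) := by
      intro b
      let ψ : MvPolynomial (Fin n) k →ₐ[k] L := (IsScalarTower.toAlgHom k B L).comp g
      have hψ : ∀ x, ψ x ∈ Algebra.adjoin k s := by
        intro x
        have h1 : ψ.range ≤ Algebra.adjoin k s := by
          rw [← Algebra.map_top, ← MvPolynomial.adjoin_range_X, AlgHom.map_adjoin]
          apply Algebra.adjoin_mono
          rintro _ ⟨_, ⟨i, rfl⟩, rfl⟩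
          exact ⟨i, rfl⟩
        exact h1 ⟨x, rfl⟩
      have h2 : (ψ : MvPolynomial (Fin n) k →+* L).IsIntegralElem (algebraMap B L b) := by
        obtain ⟨p, hp, hpx⟩ := hintg b
        refine ⟨p, hp, ?_⟩
        have := congrArg (algebraMap B L) hpx
        rw [map_zero] at this
        rw [← this]
        exact (Polynomial.hom_eval₂ p g.toRingHom (algebraMap B L) b).symm
      exact integralElem_of_comp _ _ (ψ.codRestrict _ hψ : MvPolynomial (Fin n) k →+* _)
        (by ext <;> rfl) h2
    refine ⟨fun x => ?_⟩
    obtain ⟨a, d, -, rfl⟩ := IsFractionRing.div_surjective (A := B) x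
    rw [div_eq_mul_inv]
    exact (hB a).isAlgebraic.mul (hB d).isAlgebraic.inv
  refine (Algebra.IsAlgebraic.trdeg_le_cardinalMk k s).trans ?_
  have h1 := Cardinal.mk_range_le_lift (f := fun i : Fin n => algebraMap B L (g (MvPolynomial.X i)))
  have h2 : Cardinal.lift.{0} (Cardinal.mk s) ≤ (n : Cardinal) := by simpa using h1
  rw [Cardinal.lift_uzero] at h2
  exact h2.trans (by exact_mod_cast hn)

end Curve
end AffCurve
end

section
open Polynomial

namespace AffCurve

section Curve

lemma exists_curve_prime {k B : Type*} [Field k] [CommRing B] [IsDomain B] [Algebra k B]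
    [Algebra.FiniteType k B] (β : B) (hβ : β ≠ 0) (I : Ideal B) (hI : I ≠ ⊤) :
    ∃ (q : Ideal B) (_ : q.IsPrime), β ∉ q ∧ Algebra.trdeg k q.ResidueField ≤ 1 ∧
      ∃ W : ValuationSubring q.ResidueField, (∀ b : B, algebraMap B q.ResidueField b ∈ W) ∧
        ∀ x ∈ I, W.valuation (algebraMap B q.ResidueField x) < 1 := by
  have hnoeth : IsNoetherianRing B := Algebra.FiniteType.isNoetherianRing k B
  obtain ⟨q, ⟨hqp, hβq, hqI⟩, hmax⟩ := set_has_maximal_iff_noetherian.2 hnoeth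
    {q : Ideal B | q.IsPrime ∧ β ∉ q ∧ q ⊔ I ≠ ⊤}
    ⟨⊥, Ideal.isPrime_bot, by simpa using hβ, by simpa using hI⟩
  refine ⟨q, hqp, hβq, ?_, ?_⟩
  · refine trdeg_le_one (B := B ⧸ q) (Ideal.Quotient.mk q β) ?_
      (I.map (Ideal.Quotient.mk q)) ?_ ?_
    · rwa [Ne, Ideal.Quotient.eq_zero_iff_mem]
    · intro h
      apply hqI
      have := congrArg (Ideal.comap (Ideal.Quotient.mk q)) h
      rwa [Ideal.comap_map_of_surjective _ Ideal.Quotient.mk_surjective, Ideal.comap_top,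
        ← RingHom.ker_eq_comap_bot, Ideal.mk_ker, sup_comm] at this
    · intro P hP hP0 hβP
      by_contra hcon
      have hcp : (P.comap (Ideal.Quotient.mk q)).IsPrime := Ideal.comap_isPrime _ P
      have hle : q ≤ P.comap (Ideal.Quotient.mk q) := by
        intro x hx
        rw [Ideal.mem_comap, Ideal.Quotient.eq_zero_iff_mem.2 hx]; exact P.zero_mem
      refine hmax (P.comap (Ideal.Quotient.mk q)) ⟨hcp, hβP, ?_⟩ (lt_of_le_of_ne hle ?_)
      · intro h
        apply hcon
        have := congrArg (Ideal.map (Ideal.Quotient.mk q)) h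
        rwa [Ideal.map_sup, Ideal.map_comap_of_surjective _ Ideal.Quotient.mk_surjective,
          Ideal.map_top] at this
      · intro h
        apply hP0
        have := congrArg (Ideal.map (Ideal.Quotient.mk q)) h
        rw [Ideal.map_comap_of_surjective _ Ideal.Quotient.mk_surjective, Ideal.map_quotient_self]
          at this
        exact this.symm
  · refine val_of_hom (algebraMap B (Ideal.ResidueField q)) I ?_
    intro x hx h1
    apply hqI
    rw [Ideal.eq_top_iff_one]
    have h2 : algebraMap B (Ideal.ResidueField q) (1 - x) = 0 := by rw [map_sub, h1, map_one, sub_self]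
    rw [Ideal.algebraMap_residueField_eq_zero] at h2
    have := Ideal.add_mem (q ⊔ I) (Ideal.mem_sup_left h2) (Ideal.mem_sup_right hx)
    simpa using this

universe u

theorem curve_alg {k : Type*} {K : Type u} [Field k] [Field K] [Algebra k K] (V : ValuationSubring K)
    (hV : ∀ c : k, algebraMap k K c ∈ V) {ι : Type*} [Finite ι] [Nonempty ι] (S : ι → Finset K)
    (hS : ∀ i, ∃ σ ∈ S i, σ ∉ V) :
    ∃ (R : Type u) (_ : CommRing R) (_ : IsLocalRing R) (_ : Algebra k R) (e : R →ₐ[k] K)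
      (W : ValuationSubring (IsLocalRing.ResidueField R)), Function.Injective e ∧
      Algebra.trdeg k (IsLocalRing.ResidueField R) ≤ 1 ∧
      (∀ c : k, algebraMap k (IsLocalRing.ResidueField R) c ∈ W) ∧
      ∀ i, (∀ σ ∈ S i, ∃ a, e a = σ) ∧ ∃ a, e a ∈ S i ∧ IsLocalRing.residue R a ∉ W := by
  classical
  have := Fintype.ofFinite ι
  have h1 : ∀ i, ∃ α ∈ S i, α ∉ V ∧ ∀ σ ∈ S i, V.valuation σ ≤ V.valuation α := by
    intro i
    obtain ⟨σ, hσ, hσV⟩ := hS i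
    obtain ⟨α, hα, hmax⟩ := (S i).exists_max_image V.valuation ⟨σ, hσ⟩
    refine ⟨α, hα, ?_, hmax⟩
    rw [← V.valuation_le_one_iff, not_le] at hσV ⊢
    exact hσV.trans_le (hmax σ hσ)
  choose α hαS hαV hmax using h1
  have hα0 : ∀ i, α i ≠ 0 := fun i h => hαV i (h ▸ V.zero_mem)
  have hα1 : ∀ i, 1 < V.valuation (α i) := fun i => by
    rw [← not_le, V.valuation_le_one_iff]; exact hαV i
  let T : Finset K := Finset.univ.biUnion fun i =>
    insert (α i)⁻¹ ((S i).image fun σ => σ * (α i)⁻¹)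
  let B : Subalgebra k K := Algebra.adjoin k T
  have hBT : ∀ x ∈ T, x ∈ B := fun x hx => Algebra.subset_adjoin hx
  have hαB : ∀ i, (α i)⁻¹ ∈ B := fun i => hBT _ (by
    simp only [T, Finset.mem_biUnion]; exact ⟨i, Finset.mem_univ _, Finset.mem_insert_self _ _⟩)
  have hσB : ∀ i, ∀ σ ∈ S i, σ * (α i)⁻¹ ∈ B := fun i σ hσ => hBT _ (by
    simp only [T, Finset.mem_biUnion]
    exact ⟨i, Finset.mem_univ _, Finset.mem_insert_of_mem (Finset.mem_image_of_mem _ hσ)⟩)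
  have hBV : B ≤ vsAlg V hV := by
    apply Algebra.adjoin_le
    intro x hx
    simp only [T, Finset.coe_biUnion, Set.mem_iUnion] at hx
    obtain ⟨i, -, hx⟩ := hx
    change x ∈ V
    rw [← V.valuation_le_one_iff]
    simp only [Finset.coe_insert, Finset.coe_image, Set.mem_insert_iff, Set.mem_image] at hx
    rcases hx with rfl | ⟨σ, hσ, rfl⟩
    · rw [map_inv₀]; exact (inv_lt_one_of_one_lt₀ (hα1 i)).le
    · rw [map_mul, map_inv₀, ← div_eq_mul_inv]
      exact div_le_one_of_le₀ (hmax i σ hσ) zero_le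
  let b : ι → B := fun i => ⟨(α i)⁻¹, hαB i⟩
  have hft : Algebra.FiniteType k B := (Subalgebra.fg_iff_finiteType B).1 ⟨T, rfl⟩
  let β : B := ∏ i, b i
  have hb0 : ∀ i, b i ≠ 0 := fun i h => inv_ne_zero (hα0 i) (congrArg Subtype.val h)
  have hβ : β ≠ 0 := Finset.prod_ne_zero_iff.2 fun i _ => hb0 i
  let I : Ideal B := Ideal.span (Set.range b)
  have hI : I ≠ ⊤ := by
    let ψ : B →+* V := (B.val : B →+* K).codRestrict V.toSubring (fun x => hBV x.2)
    have h2 : I ≤ (IsLocalRing.maximalIdeal V).comap ψ := by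
      rw [Ideal.span_le]
      rintro _ ⟨i, rfl⟩
      refine (V.valuation_lt_one_iff _).2 ?_
      change V.valuation (α i)⁻¹ < 1
      rw [map_inv₀]; exact inv_lt_one_of_one_lt₀ (hα1 i)
    intro h
    rw [h, top_le_iff] at h2
    exact Ideal.comap_ne_top ψ (IsLocalRing.maximalIdeal.isMaximal V).ne_top h2
  obtain ⟨q, hq, hβq, htr, W, hW, hWI⟩ := exists_curve_prime (k := k) β hβ I hI
  have hbq : ∀ i, b i ∉ q := fun i hi => hβq (Ideal.mem_of_dvd _ (Finset.dvd_prod_of_mem b (Finset.mem_univ i)) hi)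
  let e0 : Localization.AtPrime q →ₐ[k] K := IsLocalization.liftAlgHom (M := q.primeCompl)
    (f := B.val) (fun y => by
      rw [isUnit_iff_ne_zero]
      intro h
      apply y.2
      have : (y : B) = 0 := Subtype.ext h
      rw [this]; exact q.zero_mem)
  have he0 : ∀ x : B, e0 (algebraMap B _ x) = x := fun x => IsLocalization.lift_eq _ x
  have hinj : Function.Injective e0 := by
    rw [injective_iff_map_eq_zero]
    intro x hx
    obtain ⟨a, s, rfl⟩ := IsLocalization.exists_mk'_eq q.primeCompl x
    have h3 := IsLocalization.mk'_spec (Localization.AtPrime q) a s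
    have h4 := congrArg e0 h3
    rw [map_mul, hx, zero_mul, he0] at h4
    have : a = 0 := Subtype.ext h4.symm
    rw [this, IsLocalization.mk'_zero]
  have hbu : ∀ i, ∃ c : Localization.AtPrime q, c * algebraMap B _ (b i) = 1 := fun i =>
    (IsLocalization.map_units (Localization.AtPrime q) (⟨b i, hbq i⟩ : q.primeCompl)).exists_left_inv
  choose c hc using hbu
  have hec : ∀ i, e0 (c i) = α i := by
    intro i
    have := congrArg e0 (hc i)
    rw [map_mul, he0, map_one] at this
    have h5 : e0 (c i) * (α i)⁻¹ = 1 := this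
    exact (mul_inv_eq_one₀ (hα0 i)).1 h5
  refine ⟨Localization.AtPrime q, inferInstance, inferInstance, inferInstance, e0, W, hinj, htr,
    ?_, fun i => ⟨fun σ hσ => ?_, c i, ?_, ?_⟩⟩
  · intro x
    exact hW (algebraMap k B x)
  · refine ⟨algebraMap B _ ⟨_, hσB i σ hσ⟩ * c i, ?_⟩
    rw [map_mul, he0, hec]
    change σ * (α i)⁻¹ * α i = σ
    rw [mul_assoc, inv_mul_cancel₀ (hα0 i), mul_one]
  · rw [hec]; exact hαS i
  · intro hcW
    have h6 := congrArg (IsLocalRing.residue (Localization.AtPrime q)) (hc i)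
    rw [map_mul, map_one] at h6
    have h7 := congrArg W.valuation h6
    rw [map_mul, map_one] at h7
    have h8 : W.valuation (IsLocalRing.residue _ (algebraMap B (Localization.AtPrime q) (b i))) < 1 :=
      hWI (b i) (Ideal.subset_span ⟨i, rfl⟩)
    have h9 := (W.valuation_le_one_iff _).2 hcW
    have := mul_lt_one_of_nonneg_of_lt_one_right h9 zero_le h8
    exact absurd h7 this.ne

end Curve
end AffCurve
end

section
open AlgebraicGeometry CategoryTheory Opposite

namespace AffCurve
section Geo1

lemma exists_of_local {X : Scheme.{0}} {R : CommRingCat.{0}} [IsLocalRing R] (l : Spec R ⟶ X)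
    {U : X.Opens} (hU : IsAffineOpen U) (h : l (IsLocalRing.closedPoint R) ∈ U) :
    ∃ φ : Γ(X, U) ⟶ R, Spec.map φ ≫ hU.fromSpec = l := by
  have h1 : l ⁻¹ᵁ U = ⊤ := Scheme.preimage_eq_top_of_closedPoint_mem l h
  have h2 : Set.range l ⊆ Set.range hU.fromSpec := by
    rw [hU.range_fromSpec]
    rintro _ ⟨x, rfl⟩
    have : x ∈ l ⁻¹ᵁ U := h1 ▸ trivial
    exact this
  refine ⟨Spec.preimage (IsOpenImmersion.lift hU.fromSpec l h2), ?_⟩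
  rw [Spec.map_preimage, IsOpenImmersion.lift_fac]

/-- no extension along the valuation ring -/
def NC {X : Scheme.{0}} {K : Type} [Field K] (g : Spec (CommRingCat.of K) ⟶ X)
    (V : ValuationSubring K) : Prop :=
  ∀ l : Spec (CommRingCat.of V) ⟶ X, Spec.map (CommRingCat.ofHom (algebraMap V K)) ≫ l ≠ g

lemma NC.exists_not_mem {X : Scheme.{0}} {K : Type} [Field K] {g : Spec (CommRingCat.of K) ⟶ X}
    {V : ValuationSubring K} (h : NC g V) {A : CommRingCat.{0}} (m : Spec A ⟶ X)
    (φ : A ⟶ CommRingCat.of K) (hg : Spec.map φ ≫ m = g) : ∃ a : A, φ.hom a ∉ V := by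
  by_contra! hcon
  let ψ : A →+* V := φ.hom.codRestrict V.toSubring hcon
  refine h (Spec.map (CommRingCat.ofHom ψ) ≫ m) ?_
  rw [← Category.assoc, ← Spec.map_comp, ← hg]
  rfl

lemma exists_NC (k : Type) [Field k] (X : Scheme.{0}) (f : X ⟶ Spec (CommRingCat.of k))
    [IsSeparated f] [LocallyOfFiniteType f] [QuasiCompact f] (hnp : ¬ IsProper f) :
    ∃ (K : Type) (_ : Field K) (_ : Algebra k K) (V : ValuationSubring K)
      (g : Spec (CommRingCat.of K) ⟶ X),
      (∀ c : k, algebraMap k K c ∈ V) ∧ g ≫ f = Spec.map (CommRingCat.ofHom (algebraMap k K)) ∧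
      NC g V := by
  have h : ¬ ValuativeCriterion.Existence f := by
    intro h
    apply hnp
    have := UniversallyClosed.of_valuativeCriterion f h
    constructor
  simp only [ValuativeCriterion.Existence, not_forall] at h
  obtain ⟨S, hS⟩ := h
  let V : ValuationSubring S.K := ValuationSubring.ofSubring (algebraMap S.R S.K).range (by
    intro x
    rcases ValuationRing.isInteger_or_isInteger S.R x with ⟨y, hy⟩ | ⟨y, hy⟩
    · exact Or.inl ⟨y, hy⟩
    · exact Or.inr ⟨y, hy⟩)
  have hVm : ∀ r, algebraMap S.R S.K r ∈ V := fun r => ⟨r, rfl⟩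
  let ρ : S.R →+* V := (algebraMap S.R S.K).codRestrict V.toSubring hVm
  have hρ : Function.Bijective ρ := by
    constructor
    · intro a b hab
      exact IsFractionRing.injective S.R S.K (congrArg Subtype.val hab)
    · rintro ⟨_, y, rfl⟩
      exact ⟨y, rfl⟩
  let ε := RingEquiv.ofBijective ρ hρ
  let κ : CommRingCat.of k ⟶ CommRingCat.of S.R := Spec.preimage S.i₂
  have hκ : Spec.map κ = S.i₂ := Spec.map_preimage _
  letI : Algebra k S.K := ((algebraMap S.R S.K).comp κ.hom).toAlgebra
  have hf : S.i₁ ≫ f = Spec.map (CommRingCat.ofHom (algebraMap k S.K)) := by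
    rw [S.commSq.w, ← hκ, ← Spec.map_comp]
    rfl
  refine ⟨S.K, inferInstance, inferInstance, V, S.i₁, fun c => hVm _, hf, ?_⟩
  intro l hl
  apply hS
  have h2 : Spec.map (CommRingCat.ofHom (algebraMap S.R S.K)) ≫
      Spec.map (CommRingCat.ofHom (ε.symm : V →+* S.R)) =
      Spec.map (CommRingCat.ofHom (algebraMap V S.K)) := by
    rw [← Spec.map_comp]
    congr 1
    ext x
    obtain ⟨y, rfl⟩ := ε.surjective x
    change algebraMap S.R S.K (ε.symm (ε y)) = _
    rw [ε.symm_apply_apply]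
    rfl
  refine ⟨⟨Spec.map (CommRingCat.ofHom (ε.symm : V →+* S.R)) ≫ l, ?_, ?_⟩⟩
  · rw [← Category.assoc, h2, hl]
  · have h3 : Spec.map (CommRingCat.ofHom (algebraMap S.R S.K)) ≫
        (Spec.map (CommRingCat.ofHom (ε.symm : V →+* S.R)) ≫ l) ≫ f = 
        Spec.map (CommRingCat.ofHom (algebraMap S.R S.K)) ≫ S.i₂ := by
      rw [← S.commSq.w, ← hl, ← h2]; simp only [Category.assoc]
    rw [← Spec.map_preimage ((Spec.map (CommRingCat.ofHom (ε.symm : V →+* S.R)) ≫ l) ≫ f),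
      ← hκ, ← Spec.map_comp, ← Spec.map_comp] at h3
    have h4 := Spec.map_injective h3
    rw [← Spec.map_preimage ((Spec.map (CommRingCat.ofHom (ε.symm : V →+* S.R)) ≫ l) ≫ f), ← hκ]
    congr 1
    ext x
    exact IsFractionRing.injective S.R S.K (congrArg (fun t => t.hom x) h4)

end Geo1
end AffCurve
end

section
open AlgebraicGeometry CategoryTheory Opposite

namespace AffCurve
section Geo2

lemma fg_gens {k B : CommRingCat.{0}} (κ : k ⟶ B) (h : LocallyOfFiniteType (Spec.map κ)) :
    ∃ s : Finset B, ∀ (D : Type) [CommRing D] (T : Subring D) (φ : B →+* D),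
      (∀ c, φ (κ.hom c) ∈ T) → (∀ σ ∈ s, φ σ ∈ T) → ∀ x, φ x ∈ T := by
  have h1 : κ.hom.FiniteType := (HasRingHomProperty.Spec_iff (P := @LocallyOfFiniteType)).1 h
  algebraize [κ.hom]
  obtain ⟨s, hs⟩ := (‹Algebra.FiniteType k B›).out
  refine ⟨s, fun D _ T φ h1 h2 x => ?_⟩
  have : x ∈ Algebra.adjoin k (s : Set B) := hs ▸ trivial
  induction this using Algebra.adjoin_induction with
  | mem x hx => exact h2 x hx
  | algebraMap r => exact h1 r
  | add x y _ _ hx hy => rw [map_add]; exact T.add_mem hx hy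
  | mul x y _ _ hx hy => rw [map_mul]; exact T.mul_mem hx hy

theorem exists_curve_NC (k : Type) [Field k] (X : Scheme.{0}) (f : X ⟶ Spec (CommRingCat.of k))
    [LocallyOfFiniteType f] [QuasiCompact f] 
    (K : Type) [Field K] [Algebra k K] (V : ValuationSubring K)
      (g : Spec (CommRingCat.of K) ⟶ X)
      (hV : ∀ c : k, algebraMap k K c ∈ V)
      (hg : g ≫ f = Spec.map (CommRingCat.ofHom (algebraMap k K))) (hNC : NC g V) :
    ∃ (L : Type) (_ : Field L) (_ : Algebra k L) (W : ValuationSubring L)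
      (g' : Spec (CommRingCat.of L) ⟶ X), Algebra.trdeg k L ≤ 1 ∧
      (∀ c : k, algebraMap k L c ∈ W) ∧ g' ≫ f = Spec.map (CommRingCat.ofHom (algebraMap k L)) ∧
      NC g' W := by
  classical
  have hX : CompactSpace X := (quasiCompact_iff_compactSpace (f := f)).1 inferInstance
  obtain ⟨t, ht⟩ := isCompact_univ.elim_finite_subcover
    (fun U : X.affineOpens => (U.1 : Set X)) (fun U => U.1.2) (by
      intro x _
      obtain ⟨U, hU, hxU, -⟩ := X.isBasis_affineOpens.exists_subset_of_mem_open
        (Set.mem_univ x) isOpen_univ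
      obtain ⟨U', hU', rfl⟩ := hU
      exact Set.mem_iUnion.2 ⟨⟨U', hU'⟩, hxU⟩)
  let pK := IsLocalRing.closedPoint K
  let ι := {U : t // g pK ∈ U.1.1}
  have hcov : ∀ x : X, ∃ U : t, x ∈ U.1.1 := by
    intro x
    obtain ⟨U, hU⟩ := Set.mem_iUnion.1 (ht (Set.mem_univ x))
    obtain ⟨hU, hx⟩ := Set.mem_iUnion.1 hU
    exact ⟨⟨U, hU⟩, hx⟩
  have : Nonempty ι := by
    obtain ⟨U, hU⟩ := hcov (g pK)
    exact ⟨⟨U, hU⟩⟩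
  let κ : ∀ i : ι, CommRingCat.of k ⟶ Γ(X, i.1.1.1) := fun i =>
    Spec.preimage (i.1.1.2.fromSpec ≫ f)
  have hκ : ∀ i, Spec.map (κ i) = i.1.1.2.fromSpec ≫ f := fun i => Spec.map_preimage _
  have hgen := fun i => fg_gens (κ i) (by
    rw [hκ]
    have := i.1.1.2.isOpenImmersion_fromSpec
    infer_instance)
  choose s hs using hgen
  have hφ := fun i : ι => exists_of_local (R := CommRingCat.of K) g i.1.1.2 i.2
  choose φ hφ using hφ
  have hcomp : ∀ (i : ι) (D : CommRingCat.{0}) (ψ : Γ(X, i.1.1.1) ⟶ D) (τ : CommRingCat.of k ⟶ D),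
      (Spec.map ψ ≫ i.1.1.2.fromSpec) ≫ f = Spec.map τ → κ i ≫ ψ = τ := by
    intro i D ψ τ h
    apply Spec.map_injective
    rw [Spec.map_comp, hκ, ← h, Category.assoc]
  have hφk : ∀ i c, (φ i).hom ((κ i).hom c) = algebraMap k K c := fun i c =>
    congrArg (fun t => t.hom c) (hcomp i _ (φ i) _ (by rw [hφ, hg]))
  let S : ι → Finset K := fun i => (s i).image (φ i).hom
  have hS : ∀ i, ∃ σ ∈ S i, σ ∉ V := by
    intro i
    obtain ⟨a, ha⟩ := hNC.exists_not_mem _ _ (hφ i)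
    by_contra! hcon
    refine ha (hs i K V.toSubring (φ i).hom ?_ ?_ a)
    · intro c; rw [hφk]; exact hV c
    · intro σ hσ; exact hcon _ (Finset.mem_image_of_mem _ hσ)
  obtain ⟨R, _, _, _, e, W, he, htr, hW, hR⟩ := curve_alg V hV S hS
  have hψ : ∀ i, ∃ ψ : Γ(X, i.1.1.1) ⟶ CommRingCat.of R, 
      ψ ≫ CommRingCat.ofHom (e : R →+* K) = φ i := by
    intro i
    have h1 := hs i K (e : R →+* K).range (φ i).hom (fun c => by
      rw [hφk]; exact ⟨algebraMap k R c, e.commutes c⟩) (fun σ hσ =>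
        (hR i).1 _ (Finset.mem_image_of_mem _ hσ))
    choose p hp using h1
    have hp' : ∀ x, e (p x) = (φ i).hom x := hp
    refine ⟨CommRingCat.ofHom ⟨⟨⟨p, ?_⟩, ?_⟩, ?_, ?_⟩, ?_⟩
    · apply he; simp [hp']
    · intro x y; apply he; simp [hp']
    · apply he; simp [hp']
    · intro x y; apply he; simp [hp']
    · ext x; exact hp x
  choose ψ hψ using hψ
  obtain ⟨i0⟩ := id this
  let lam : Spec (CommRingCat.of R) ⟶ X := Spec.map (ψ i0) ≫ i0.1.1.2.fromSpec
  have hlam : Spec.map (CommRingCat.ofHom (e : R →+* K)) ≫ lam = g := by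
    simp only [lam]
    rw [← Category.assoc, ← Spec.map_comp, hψ, hφ]
  have hψk : κ i0 ≫ ψ i0 = CommRingCat.ofHom (algebraMap k R) := by
    ext c
    apply he
    have h1 : e ((ψ i0).hom ((κ i0).hom c)) = (φ i0).hom ((κ i0).hom c) :=
      congrArg (fun t => t.hom ((κ i0).hom c)) (hψ i0)
    rw [hφk] at h1
    refine h1.trans (e.commutes c).symm
  let L := IsLocalRing.ResidueField R
  let res : CommRingCat.of R ⟶ CommRingCat.of L := CommRingCat.ofHom (IsLocalRing.residue R)
  let g' : Spec (CommRingCat.of L) ⟶ X := Spec.map res ≫ lam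
  refine ⟨L, inferInstance, inferInstance, W, g', htr, hW, ?_, ?_⟩
  · simp only [g', lam, Category.assoc]
    rw [← hκ, ← Spec.map_comp, hψk, ← Spec.map_comp]
    rfl
  intro l hl
  obtain ⟨U, hU⟩ := hcov (l (IsLocalRing.closedPoint W))
  obtain ⟨χ, hχ⟩ := exists_of_local (R := CommRingCat.of W) l U.1.2 hU
  have h1 : lam (IsLocalRing.closedPoint R) ∈ U.1.1 := by
    have h8 : l ⁻¹ᵁ U.1.1 = ⊤ := Scheme.preimage_eq_top_of_closedPoint_mem l hU
    have h9 : Spec.map res (IsLocalRing.closedPoint L) = IsLocalRing.closedPoint R :=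
      @Spec_closedPoint (CommRingCat.of R) (CommRingCat.of L) _ _ res
        (inferInstanceAs (IsLocalHom (IsLocalRing.residue R)))
    rw [← h9]
    change g' (IsLocalRing.closedPoint L) ∈ U.1.1
    rw [← hl]
    have : Spec.map (CommRingCat.ofHom (algebraMap W L)) (IsLocalRing.closedPoint L) ∈
      l ⁻¹ᵁ U.1.1 := h8 ▸ trivial
    exact this
  obtain ⟨ψ', hψ'⟩ := exists_of_local (R := CommRingCat.of R) lam U.1.2 h1
  have h2 : Spec.map (ψ' ≫ CommRingCat.ofHom (e : R →+* K)) ≫ U.1.2.fromSpec = g := by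
    rw [Spec.map_comp, Category.assoc, hψ', hlam]
  have h3 : g pK ∈ U.1.1 := by
    have h8 : lam ⁻¹ᵁ U.1.1 = ⊤ := Scheme.preimage_eq_top_of_closedPoint_mem lam h1
    rw [← hlam]
    have : Spec.map (CommRingCat.ofHom (e : R →+* K)) pK ∈ lam ⁻¹ᵁ U.1.1 := h8 ▸ trivial
    exact this
  have := U.1.2.isOpenImmersion_fromSpec
  let j : ι := ⟨U, h3⟩
  have h4 : ψ' ≫ CommRingCat.ofHom (e : R →+* K) = φ j := by
    apply Spec.map_injective
    rw [← cancel_mono U.1.2.fromSpec, h2]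
    exact (hφ j).symm
  obtain ⟨a, ha, haW⟩ := (hR j).2
  obtain ⟨x, hx, hxa⟩ := Finset.mem_image.1 ha
  have h5 : ψ'.hom x = a := by
    apply he
    rw [← hxa, ← h4]; rfl
  apply haW
  have h6 : χ ≫ CommRingCat.ofHom (algebraMap W L) = ψ' ≫ res := by
    apply Spec.map_injective
    rw [← cancel_mono U.1.2.fromSpec, Spec.map_comp, Spec.map_comp, Category.assoc, Category.assoc,
      hχ, hψ', hl]
  have h7 : ((χ.hom x : W) : L) = IsLocalRing.residue R (ψ'.hom x) :=
    congrArg (fun t => t.hom x) h6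
  rw [← h5, ← h7]
  exact (χ.hom x).2

end Geo2
end AffCurve
end

section
open AlgebraicGeometry CategoryTheory Opposite

namespace AffCurve
section Geo3

lemma isIntegral_image {X : Scheme.{0}} {L : Type} [Field L] (g : Spec (CommRingCat.of L) ⟶ X) :
    IsIntegral g.image := by
  have hqc : QuasiCompact g := inferInstance
  have hred : AlgebraicGeometry.IsReduced g.image := by
    have : ∀ i, AlgebraicGeometry.IsReduced (g.ker.subschemeCover.openCover.X i) := by
      intro U'
      let U : X.affineOpens := U'
      have h1 : (g.ker.ideal U).IsRadical := by
        rw [Scheme.Hom.ker_apply]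
        intro x hx
        obtain ⟨n, hn⟩ := hx
        rw [RingHom.mem_ker, map_pow] at hn
        exact eq_zero_of_pow_eq_zero hn
      have h2 : _root_.IsReduced (Γ(X, U.1) ⧸ g.ker.ideal U) :=
        (Ideal.isRadical_iff_quotient_reduced _).1 h1
      change AlgebraicGeometry.IsReduced (Spec (CommRingCat.of (Γ(X, U.1) ⧸ g.ker.ideal U)))
      have : _root_.IsReduced (CommRingCat.of (Γ(X, U.1) ⧸ g.ker.ideal U)) := h2
      infer_instance
    exact IsReduced.of_openCover _ g.ker.subschemeCover.openCover
  have hirr : IrreducibleSpace g.image := by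
    have hd : DenseRange g.toImage := g.toImage.denseRange
    have : IsIrreducible (Set.range g.toImage) := by
      rw [← Set.image_univ]
      exact (IrreducibleSpace.isIrreducible_univ _).image _ g.toImage.continuous.continuousOn
    have h2 := this.closure
    rw [hd.closure_range] at h2
    exact irreducibleSpace_def _ |>.2 h2
  exact isIntegral_of_irreducibleSpace_of_isReduced _

lemma exists_field (R : CommRingCat.{0}) (h : IsField R) :
    ∃ (F : Type) (_ : Field F), Nonempty (R ≅ CommRingCat.of F) := by
  letI := h.toField
  exact ⟨R, h.toField, ⟨Iso.refl R⟩⟩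

theorem exists_integral_NC (k : Type) [Field k] (X : Scheme.{0}) (f : X ⟶ Spec (CommRingCat.of k))
    (L : Type) [Field L] [Algebra k L] (W : ValuationSubring L)
      (g : Spec (CommRingCat.of L) ⟶ X) (htr : Algebra.trdeg k L ≤ 1)
      (hW : ∀ c : k, algebraMap k L c ∈ W)
      (hg : g ≫ f = Spec.map (CommRingCat.ofHom (algebraMap k L))) (hNC : NC g W) :
    ∃ (C : Scheme.{0}) (i : C ⟶ X) (_ : IsIntegral C) (F : Type) (_ : Field F) (_ : Algebra k F)
      (V : ValuationSubring F) (η : C.functionField ≅ CommRingCat.of F), IsClosedImmersion i ∧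
      Algebra.trdeg k F ≤ 1 ∧ (∀ c : k, algebraMap k F c ∈ V) ∧
      (Spec.map η.hom ≫ C.fromSpecStalk (genericPoint C)) ≫ i ≫ f =
        Spec.map (CommRingCat.ofHom (algebraMap k F)) ∧
      NC (Spec.map η.hom ≫ C.fromSpecStalk (genericPoint C)) V := by
  have hI := isIntegral_image g
  let C := g.image
  let h : Spec (CommRingCat.of L) ⟶ C := g.toImage
  have hqc : QuasiCompact g := inferInstance
  have hd : DenseRange h := g.toImage.denseRange
  have hpt : h (IsLocalRing.closedPoint L) = genericPoint C := by
    have h1 : Set.range h = {h (IsLocalRing.closedPoint L)} := by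
      ext x
      constructor
      · rintro ⟨y, rfl⟩
        have : Subsingleton (PrimeSpectrum L) := inferInstance
        exact congrArg h (this.elim y (IsLocalRing.closedPoint L))
      · rintro rfl; exact ⟨_, rfl⟩
    have h2 : IsGenericPoint (h (IsLocalRing.closedPoint L)) Set.univ := by
      rw [isGenericPoint_def, ← h1]; exact hd.closure_range
    exact h2.eq (genericPoint_spec C)
  obtain ⟨F, _, ⟨η⟩⟩ := exists_field C.functionField (Field.toIsField _)
  let γ : Spec (CommRingCat.of F) ⟶ C := Spec.map η.hom ≫ C.fromSpecStalk (genericPoint C)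
  have hσ : ∃ σ : CommRingCat.of F ⟶ CommRingCat.of L, Spec.map σ ≫ γ = h := by
    have : ∀ x, h (IsLocalRing.closedPoint L) = x →
        ∃ σ : C.presheaf.stalk x ⟶ CommRingCat.of L, Spec.map σ ≫ C.fromSpecStalk x = h := by
      rintro x rfl
      exact ⟨_, Scheme.Spec_stalkClosedPointTo_fromSpecStalk (R := CommRingCat.of L) h⟩
    obtain ⟨σ, hσ⟩ := this _ hpt
    refine ⟨η.inv ≫ σ, ?_⟩
    rw [← hσ]
    simp only [γ, ← Category.assoc, ← Spec.map_comp, Iso.hom_inv_id, Category.id_comp]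
  obtain ⟨σ, hσ⟩ := hσ
  let κ : CommRingCat.of k ⟶ CommRingCat.of F :=
    Spec.preimage (γ ≫ g.imageι ≫ f)
  have hκ : Spec.map κ = γ ≫ g.imageι ≫ f := Spec.map_preimage _
  have hκσ : κ ≫ σ = CommRingCat.ofHom (algebraMap k L) := by
    apply Spec.map_injective
    rw [Spec.map_comp, hκ, ← hg, ← Category.assoc, hσ, ← Category.assoc, g.toImage_imageι]
  let : Algebra k F := κ.hom.toAlgebra
  let σ' : F →ₐ[k] L := { σ.hom with
    commutes' := fun c => congrArg (fun t => t.hom c) hκσ }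
  let V : ValuationSubring F := W.comap σ.hom
  refine ⟨C, g.imageι, hI, F, inferInstance, inferInstance, V, η, inferInstance, ?_, ?_, ?_, ?_⟩
  · exact (trdeg_le_of_injective σ' σ'.toRingHom.injective).trans htr
  · intro c
    change σ.hom (κ.hom c) ∈ W
    have : σ.hom (κ.hom c) = algebraMap k L c := congrArg (fun t => t.hom c) hκσ
    rw [this]; exact hW c
  · exact hκ.symm
  · intro l hl
    let τ : V →+* W := (σ.hom.comp V.subtype).codRestrict W.toSubring (fun x => x.2)
    refine hNC (Spec.map (CommRingCat.ofHom τ) ≫ l ≫ g.imageι) ?_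
    have h1 : Spec.map (CommRingCat.ofHom (algebraMap W L)) ≫ Spec.map (CommRingCat.ofHom τ) =
      Spec.map σ ≫ Spec.map (CommRingCat.ofHom (algebraMap V F)) := by
      rw [← Spec.map_comp, ← Spec.map_comp]; rfl
    rw [← Category.assoc, h1, Category.assoc, ← Category.assoc _ l, hl, ← Category.assoc, hσ,
      g.toImage_imageι]

end Geo3
end AffCurve
end

section
namespace AffCurve
section Dim

lemma krullDimLE_one {k B F : Type} [Field k] [CommRing B] [IsDomain B] [Algebra k B]
    [Algebra.FiniteType k B] [Field F] [Algebra k F] (φ : B →ₐ[k] F) (hφ : Function.Injective φ)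
    (htr : Algebra.trdeg k F ≤ 1) : Ring.KrullDimLE 1 B := by
  obtain ⟨n, g, hinj, hintg⟩ := exists_integral_inj_algHom_of_fg k B
  have hn : n ≤ 1 := by
    have h1 : AlgebraicIndependent k (fun i : Fin n => (φ.comp g) (MvPolynomial.X i)) :=
      (MvPolynomial.algebraicIndependent_X (Fin n) k).map' (f := φ.comp g) (hφ.comp hinj)
    have h2 := h1.cardinalMk_le_trdeg.trans htr
    simpa using h2
  have hK : Ring.KrullDimLE 1 (MvPolynomial (Fin n) k) := by
    rw [Ring.krullDimLE_iff, MvPolynomial.ringKrullDim_of_isNoetherianRing,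
      ringKrullDim_eq_zero_of_field, zero_add, Nat.card_fin]
    exact_mod_cast hn
  rw [Ring.krullDimLE_one_iff_of_noZeroDivisors]
  intro I hI0 hI
  let _ := g.toRingHom.toAlgebra
  have : FaithfulSMul (MvPolynomial (Fin n) k) B :=
    (faithfulSMul_iff_algebraMap_injective _ _).2 hinj
  have : Algebra.IsIntegral (MvPolynomial (Fin n) k) B := ⟨hintg⟩
  apply Ideal.isMaximal_of_isIntegral_of_isMaximal_comap (R := MvPolynomial (Fin n) k)
  refine Ideal.IsPrime.isMaximal_of_ne_bot inferInstance ?_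
  intro h0
  exact hI0 (Ideal.eq_bot_of_comap_eq_bot h0)

lemma finite_zeroLocus {B : Type} [CommRing B] [IsDomain B] [IsNoetherianRing B]
    [Ring.KrullDimLE 1 B] (Z : Set (PrimeSpectrum B)) (hZ : IsClosed Z) (h0 : (⊥ : PrimeSpectrum B) ∉ Z) :
    Z.Finite ∧ ∀ z ∈ Z, IsClosed {z} := by
  obtain ⟨I, rfl⟩ := (PrimeSpectrum.isClosed_iff_zeroLocus_ideal _).1 hZ
  have hI : I ≠ ⊥ := by
    rintro rfl
    apply h0
    rw [PrimeSpectrum.mem_zeroLocus]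
    intro x hx
    rw [SetLike.mem_coe, Ideal.mem_bot] at hx
    rw [hx]
    exact Ideal.zero_mem _
  have hne : ∀ p : Ideal B, I ≤ p → p ≠ ⊥ := fun p hp h => hI (le_bot_iff.1 (h ▸ hp))
  refine ⟨?_, ?_⟩
  · refine Set.Finite.of_finite_image (f := PrimeSpectrum.asIdeal)
      ((Ideal.finite_minimalPrimes_of_isNoetherianRing B I).subset ?_) ?_
    · rintro _ ⟨p, hp, rfl⟩
      obtain ⟨q, hq, hqp⟩ := Ideal.exists_minimalPrimes_le (I := I) (J := p.asIdeal) hp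
      have hqm : q.IsMaximal := Ideal.IsPrime.isMaximal_of_ne_bot hq.1.1 (hne _ hq.1.2)
      rw [← hqm.eq_of_le p.2.ne_top hqp]
      exact hq
    · intro a _ b _ h
      exact PrimeSpectrum.ext h
  · intro z hz
    rw [PrimeSpectrum.isClosed_singleton_iff_isMaximal]
    exact Ideal.IsPrime.isMaximal_of_ne_bot z.2 (hne _ hz)

lemma dim_eq_one {k B F : Type} [Field k] [CommRing B] [IsDomain B] [Algebra k B]
    [Algebra.FiniteType k B] [Field F] [Algebra k F] (φ : B →ₐ[k] F) (hφ : Function.Injective φ)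
    (htr : Algebra.trdeg k F ≤ 1) (V : ValuationSubring F) (hV : ∀ c : k, algebraMap k F c ∈ V)
    (hBV : ∃ b, φ b ∉ V) : ringKrullDim B = 1 ∧ ¬ Module.Finite k B := by
  have hfin : ¬ Module.Finite k B := by
    intro hf
    obtain ⟨b, hb⟩ := hBV
    apply hb
    refine mem_of_integralElem (algebraMap k F) V hV ?_
    exact (Algebra.IsIntegral.isIntegral (R := k) b).map φ
  refine ⟨?_, hfin⟩
  have h1 := krullDimLE_one φ hφ htr
  apply le_antisymm
  · simpa using Ring.krullDimLE_iff.1 h1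
  · by_contra! hlt
    have h2 : ringKrullDim B ≤ 0 := by
      generalize ringKrullDim B = d at hlt
      induction d with
      | bot => exact bot_le
      | coe d =>
        have h5 : d < 1 := by exact_mod_cast hlt
        rw [ENat.lt_one_iff_eq_zero] at h5
        rw [h5]; rfl
    have h3 : Ring.KrullDimLE 0 B := Ring.krullDimLE_iff.2 (by simpa using h2)
    have h4 : IsField B := Ring.KrullDimLE.isField_of_isDomain
    apply hfin
    let _ := h4.toField
    exact finite_of_finite_type_of_isJacobsonRing k B

end Dim
end AffCurve
end

section
open AlgebraicGeometry CategoryTheory Opposite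

namespace AffCurve
section Geo4

/-- range of a ring hom as a subalgebra -/
def rangeAlg {k F A : Type} [Field k] [Field F] [Algebra k F] [CommRing A] (φ : A →+* F)
    (h : ∀ c, algebraMap k F c ∈ φ.range) : Subalgebra k F :=
  { φ.range with algebraMap_mem' := h }

lemma mem_rangeAlg {k F A : Type} [Field k] [Field F] [Algebra k F] [CommRing A] (φ : A →+* F)
    (h : ∀ c, algebraMap k F c ∈ φ.range) (x : F) : x ∈ rangeAlg φ h ↔ ∃ a, φ a = x := Iff.rfl

lemma rangeAlg_frac {k F A : Type} [Field k] [Field F] [Algebra k F] [CommRing A] (φ : A →+* F)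
    (h : ∀ c, algebraMap k F c ∈ φ.range) (hf : ∀ x : F, ∃ a b, x = φ a / φ b) :
    IsFractionRing (rangeAlg φ h) F := by
  apply IsFractionRing.of_field
  intro z
  obtain ⟨a, b, hab⟩ := hf z
  exact ⟨⟨φ a, a, rfl⟩, ⟨φ b, b, rfl⟩, hab⟩

/-- equivalence onto the range -/
noncomputable def rangeEquiv {k F A : Type} [Field k] [Field F] [Algebra k F] [CommRing A]
    (φ : A →+* F)
    (h : ∀ c, algebraMap k F c ∈ φ.range) (hi : Function.Injective φ) : A ≃+* rangeAlg φ h :=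
  RingEquiv.ofBijective (φ.codRestrict (rangeAlg φ h) (fun a => ⟨a, rfl⟩))
    ⟨fun a b hab => hi (congrArg Subtype.val hab), by rintro ⟨_, a, rfl⟩; exact ⟨a, rfl⟩⟩

lemma rangeAlg_fg {k F A : Type} [Field k] [Field F] [Algebra k F] [CommRing A] (φ : A →+* F)
    (h : ∀ c, algebraMap k F c ∈ φ.range) (κ : k →+* A) (hκ : κ.FiniteType)
    (hc : φ.comp κ = algebraMap k F) : (rangeAlg φ h).FG := by
  let _ := κ.toAlgebra
  have : Algebra.FiniteType k A := hκ
  let ψ : A →ₐ[k] F := { φ with commutes' := fun c => congrArg (fun t => t c) hc }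
  have h1 : rangeAlg φ h = ψ.range := by ext x; exact Iff.rfl
  rw [h1]
  rw [← Algebra.map_top]
  exact Subalgebra.FG.map _ Algebra.FiniteType.out

variable {C : Scheme.{0}} [IsIntegral C] {F : Type} [Field F]
  (η : C.functionField ≅ CommRingCat.of F)

lemma gp_mem (U : C.Opens) (h : Nonempty U) : genericPoint C ∈ U :=
  ((genericPoint_spec C).mem_open_set_iff U.isOpen).mpr (by simpa using h)

/-- sections to the field -/
noncomputable def phi (U : C.Opens) [Nonempty U] : Γ(C, U) ⟶ CommRingCat.of F :=
  C.germToFunctionField U ≫ η.hom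

/-- stalks to the field -/
noncomputable def theta (z : C) : C.presheaf.stalk z ⟶ CommRingCat.of F :=
  C.presheaf.stalkSpecializes ((genericPoint_spec C).specializes trivial) ≫ η.hom

lemma eta_inj : Function.Injective η.hom.hom := η.commRingCatIsoToRingEquiv.injective

lemma phi_inj (U : C.Opens) [Nonempty U] : Function.Injective (phi η U).hom :=
  (eta_inj η).comp (C.germToFunctionField_injective U)

lemma theta_inj (z : C) : Function.Injective (theta η z).hom :=
  (eta_inj η).comp (IsFractionRing.injective (C.presheaf.stalk z) C.functionField)

lemma germ_theta (U : C.Opens) [Nonempty U] (z : C) (hz : z ∈ U) :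
    C.presheaf.germ U z hz ≫ theta η z = phi η U := by
  simp [theta, phi]

lemma res_phi (U V : C.Opens) [Nonempty U] [Nonempty V] (i : U ⟶ V) :
    C.presheaf.map i.op ≫ phi η U = phi η V := by
  simp [phi]

/-- the generic map -/
noncomputable def gam : Spec (CommRingCat.of F) ⟶ C :=
  Spec.map η.hom ≫ C.fromSpecStalk (genericPoint C)

lemma phi_gam {U : C.Opens} [h : Nonempty U] (hU : IsAffineOpen U) :
    Spec.map (phi η U) ≫ hU.fromSpec = gam η := by
  rw [phi, gam, Spec.map_comp, Category.assoc, ← hU.fromSpecStalk_eq_fromSpecStalk (gp_mem U h)]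
  rfl

lemma theta_gam (z : C) : Spec.map (theta η z) ≫ C.fromSpecStalk z = gam η := by
  rw [theta, gam, Spec.map_comp, Category.assoc, Scheme.SpecMap_stalkSpecializes_fromSpecStalk]

lemma frac_of {A : Type} [CommRing A] [Algebra A C.functionField]
    [IsFractionRing A C.functionField] (x : F) :
    ∃ a b : A, x = η.hom.hom (algebraMap A C.functionField a) /
      η.hom.hom (algebraMap A C.functionField b) := by
  obtain ⟨a, b, hb, h⟩ := IsFractionRing.div_surjective (A := A) (η.inv.hom x)
  refine ⟨a, b, ?_⟩
  have h1 : x = η.hom.hom (η.inv.hom x) := by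
    exact (congrArg (fun t => t.hom x) η.inv_hom_id).symm
  rw [h1, ← h]
  let e : C.functionField →+* F := η.hom.hom
  exact map_div₀ e _ _

lemma phi_frac {U : C.Opens} [h : Nonempty U] (hU : IsAffineOpen U) (x : F) :
    ∃ a b, x = (phi η U).hom a / (phi η U).hom b := by
  have := functionField_isFractionRing_of_isAffineOpen C U hU
  exact frac_of η x

lemma theta_frac (z : C) (x : F) :
    ∃ a b, x = (theta η z).hom a / (theta η z).hom b := 
  frac_of (A := C.presheaf.stalk z) η x

variable {k : Type} [Field k] [Algebra k F] (f : C ⟶ Spec (CommRingCat.of k))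

lemma kap (hγ : gam η ≫ f = Spec.map (CommRingCat.ofHom (algebraMap k F))) {A : CommRingCat.{0}}
    (m : Spec A ⟶ C) (φ : A ⟶ CommRingCat.of F) (hφ : Spec.map φ ≫ m = gam η) :
    φ.hom.comp (Spec.preimage (m ≫ f)).hom = algebraMap k F := by
  have : Spec.preimage (m ≫ f) ≫ φ = CommRingCat.ofHom (algebraMap k F) := by
    apply Spec.map_injective
    rw [Spec.map_comp, Spec.map_preimage, ← hγ, ← hφ, Category.assoc]
  exact congrArg (fun t => t.hom) this

lemma kap_mem (hγ : gam η ≫ f = Spec.map (CommRingCat.ofHom (algebraMap k F))) {A : CommRingCat.{0}}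
    (m : Spec A ⟶ C) (φ : A ⟶ CommRingCat.of F) (hφ : Spec.map φ ≫ m = gam η) (c : k) :
    algebraMap k F c ∈ φ.hom.range := 
  ⟨(Spec.preimage (m ≫ f)).hom c, congrArg (fun t => t c) (kap η f hγ m φ hφ)⟩

lemma kap_ft [LocallyOfFiniteType f] {U : C.Opens} (hU : IsAffineOpen U) :
    (Spec.preimage (hU.fromSpec ≫ f)).hom.FiniteType := by
  have := hU.isOpenImmersion_fromSpec
  rw [← HasRingHomProperty.Spec_iff (P := @LocallyOfFiniteType), Spec.map_preimage]
  infer_instance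

end Geo4
end AffCurve
end

section
open AlgebraicGeometry CategoryTheory Opposite

namespace AffCurve
section Geo5

variable {C : Scheme.{0}} [IsIntegral C] {F : Type} [Field F]
  (η : C.functionField ≅ CommRingCat.of F)
variable {k : Type} [Field k] [Algebra k F] (f : C ⟶ Spec (CommRingCat.of k))

lemma sep_contra [IsSeparated f]
    (hγ : gam η ≫ f = Spec.map (CommRingCat.ofHom (algebraMap k F)))
    {U : C.Opens} [Nonempty U] (hU : IsAffineOpen U) (z : C) (hz : z ∉ U) (W : ValuationSubring F)
    (h1 : ∀ a, (phi η U).hom a ∈ W) (h2 : ∀ a, (theta η z).hom a ∈ W)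
    (h3 : ∀ a ∈ IsLocalRing.maximalIdeal (C.presheaf.stalk z),
      W.valuation ((theta η z).hom a) < 1) : False := by
  let u : Γ(C, U) →+* W := (phi η U).hom.codRestrict W.toSubring h1
  let v : C.presheaf.stalk z →+* W := (theta η z).hom.codRestrict W.toSubring h2
  let l1 : Spec (CommRingCat.of W) ⟶ C := Spec.map (CommRingCat.ofHom u) ≫ hU.fromSpec
  let l2 : Spec (CommRingCat.of W) ⟶ C := Spec.map (CommRingCat.ofHom v) ≫ C.fromSpecStalk z
  let r := Spec.map (CommRingCat.ofHom (algebraMap W F))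
  have e1 : r ≫ l1 = gam η := by
    rw [← phi_gam η hU, ← Category.assoc, ← Spec.map_comp]; rfl
  have e2 : r ≫ l2 = gam η := by
    rw [← theta_gam η z, ← Category.assoc, ← Spec.map_comp]; rfl
  have e3 : l1 ≫ f = l2 ≫ f := by
    rw [← Spec.map_preimage (l1 ≫ f), ← Spec.map_preimage (l2 ≫ f)]
    congr 1
    have : ∀ l : Spec (CommRingCat.of W) ⟶ C, r ≫ l = gam η →
        Spec.preimage (l ≫ f) ≫ CommRingCat.ofHom (algebraMap W F) =
          CommRingCat.ofHom (algebraMap k F) := by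
      intro l hl
      apply Spec.map_injective
      rw [Spec.map_comp, Spec.map_preimage, ← Category.assoc, hl, hγ]
    have h4 := (this l1 e1).trans (this l2 e2).symm
    ext c
    exact congrArg (fun t => t.hom c) h4
  have e4 : l1 = l2 := by
    let S : ValuativeCommSq f :=
      { R := W, K := F, i₁ := gam η, i₂ := l1 ≫ f, commSq := ⟨by rw [← Category.assoc, e1]⟩ }
    have := IsSeparated.valuativeCriterion f S
    have h5 := this.elim ⟨l1, e1, rfl⟩ ⟨l2, e2, e3.symm⟩
    exact congrArg CommSq.LiftStruct.l h5
  have hloc : IsLocalHom v := by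
    constructor
    intro a ha
    by_contra hna
    have h6 := h3 a hna
    have h7 : W.valuation ((v a : W) : F) = 1 := by
      exact (W.valuation_eq_one_iff (v a)).1 ha
    exact absurd h7 h6.ne
  have h8 : l2 (IsLocalRing.closedPoint W) = z := by
    have : Spec.map (CommRingCat.ofHom v) (IsLocalRing.closedPoint W) =
        IsLocalRing.closedPoint (C.presheaf.stalk z) :=
      IsLocalRing.comap_closedPoint v
    exact (congrArg (C.fromSpecStalk z) this).trans Scheme.fromSpecStalk_closedPoint
  have h9 : l1 (IsLocalRing.closedPoint W) ∈ U := by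
    have h10 : l1 (IsLocalRing.closedPoint W) ∈ Set.range hU.fromSpec :=
      ⟨Spec.map (CommRingCat.ofHom u) (IsLocalRing.closedPoint W), rfl⟩
    rw [hU.range_fromSpec] at h10
    exact h10
  rw [e4, h8] at h9
  exact hz h9

lemma near_pt [LocallyOfFiniteType f] (htr : Algebra.trdeg k F ≤ 1)
    (hγ : gam η ≫ f = Spec.map (CommRingCat.ofHom (algebraMap k F)))
    (U : C.Opens) [hne : Nonempty U] (z : C) :
    ∃ N : C.Opens, IsAffineOpen N ∧ z ∈ N ∧ ∀ w ∈ N, w ∉ U → w = z := by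
  obtain ⟨_, ⟨V, hV : IsAffineOpen V, rfl⟩, hzV, -⟩ :=
    C.isBasis_affineOpens.exists_subset_of_mem_open (Set.mem_univ z) isOpen_univ
  have hVn : Nonempty V := ⟨⟨z, hzV⟩⟩
  have := hV.isOpenImmersion_fromSpec
  let κ := (Spec.preimage (hV.fromSpec ≫ f)).hom
  let _ : Algebra k Γ(C, V) := κ.toAlgebra
  have : Algebra.FiniteType k Γ(C, V) := kap_ft f hV
  let ψ : Γ(C, V) →ₐ[k] F := { (phi η V).hom with
    commutes' := fun c => congrArg (fun t => t c) (kap η f hγ _ _ (phi_gam η hV)) }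
  have hK : Ring.KrullDimLE 1 Γ(C, V) := krullDimLE_one ψ (phi_inj η V) htr
  have hN : IsNoetherianRing Γ(C, V) := Algebra.FiniteType.isNoetherianRing k _
  have hemb := hV.fromSpec.isOpenEmbedding
  let Z : Set (PrimeSpectrum Γ(C, V)) := hV.fromSpec ⁻¹' (U : Set C)ᶜ
  have hZ : IsClosed Z := U.isOpen.isClosed_compl.preimage hV.fromSpec.continuous
  have h0 : (⊥ : PrimeSpectrum Γ(C, V)) ∉ Z := by
    intro h0
    obtain ⟨y, hy⟩ : genericPoint C ∈ Set.range hV.fromSpec := by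
      rw [hV.range_fromSpec]; exact gp_mem V hVn
    have h1 : y ∈ Z := by
      have : (⊥ : PrimeSpectrum Γ(C, V)) ⤳ y :=
        (PrimeSpectrum.le_iff_specializes (⊥ : PrimeSpectrum Γ(C, V)) y).1 bot_le
      exact this.mem_closed hZ h0
    apply h1
    rw [SetLike.mem_coe, hy]
    exact gp_mem U hne
  obtain ⟨hfin, hcl⟩ := finite_zeroLocus Z hZ h0
  obtain ⟨y, hy⟩ : z ∈ Set.range hV.fromSpec := by rw [hV.range_fromSpec]; exact hzV
  have hcl2 : IsClosed (Z \ {y}) := by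
    rw [← Set.biUnion_of_singleton (Z \ {y})]
    exact (hfin.subset Set.sdiff_subset).isClosed_biUnion fun w hw => hcl w hw.1
  have hop : IsOpen (hV.fromSpec '' (Z \ {y})ᶜ) := hemb.isOpenMap _ hcl2.isOpen_compl
  obtain ⟨_, ⟨N, hN : IsAffineOpen N, rfl⟩, hzN, hNle⟩ :=
    C.isBasis_affineOpens.exists_subset_of_mem_open
      (show z ∈ hV.fromSpec '' (Z \ {y})ᶜ from ⟨y, fun h => h.2 rfl, hy⟩) hop
  refine ⟨N, hN, hzN, ?_⟩
  intro w hw hwU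
  obtain ⟨y', hy', rfl⟩ := hNle hw
  have : y' = y := by
    by_contra hne
    exact hy' ⟨hwU, hne⟩
  rw [this, hy]

end Geo5
end AffCurve
end

section
open AlgebraicGeometry CategoryTheory Opposite

namespace AffCurve
section Geo6

variable {C : Scheme.{0}} [IsIntegral C] {F : Type} [Field F]
  (η : C.functionField ≅ CommRingCat.of F)
variable {k : Type} [Field k] [Algebra k F] (f : C ⟶ Spec (CommRingCat.of k))

lemma apply_core [IsSeparated f] [LocallyOfFiniteType f] (htr : Algebra.trdeg k F ≤ 1)
    (hγ : gam η ≫ f = Spec.map (CommRingCat.ofHom (algebraMap k F)))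
    (V : ValuationSubring F) (hV : ∀ c : k, algebraMap k F c ∈ V) (hNC : NC (gam η) V)
    {U : C.Opens} [Nonempty U] (hU : IsAffineOpen U) (z : C) (hz : z ∉ U)
    (j : Γ(C, U)) (hj : (phi η U).hom j ≠ 0) :
    ∃ (a : Γ(C, U)) (b : C.presheaf.stalk z), ¬ IsUnit b ∧
      (theta η z).hom b = 1 - (phi η U).hom (j * a) := by
  have hA' := kap_mem η f hγ _ _ (phi_gam η hU)
  have hO' := kap_mem η f hγ _ _ (theta_gam η z)
  let A := rangeAlg (phi η U).hom hA'
  let O := rangeAlg (theta η z).hom hO'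
  have hA : A.FG := rangeAlg_fg _ hA' _ (kap_ft f hU) (kap η f hγ _ _ (phi_gam η hU))
  have i1 : IsFractionRing A F := rangeAlg_frac _ _ (phi_frac η hU)
  have i2 : IsFractionRing O F := rangeAlg_frac _ _ (theta_frac η z)
  let e : C.presheaf.stalk z ≃+* O := rangeEquiv _ hO' (theta_inj η z)
  have i3 : IsLocalRing O := e.isLocalRing
  have hAV : ∃ x ∈ A, x ∉ V := by
    obtain ⟨a, ha⟩ := hNC.exists_not_mem _ _ (phi_gam η hU)
    exact ⟨_, ⟨a, rfl⟩, ha⟩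
  have hOV : ∃ x ∈ O, x ∉ V := by
    obtain ⟨a, ha⟩ := hNC.exists_not_mem _ _ (theta_gam η z)
    exact ⟨_, ⟨a, rfl⟩, ha⟩
  obtain ⟨_, ⟨a, rfl⟩, b, hb, hab⟩ := core htr A O hA V hV hAV hOV (by
    intro W h1 h2 h3
    refine sep_contra η f hγ hU z hz W (fun a => h1 _ ⟨a, rfl⟩) (fun a => h2 _ ⟨a, rfl⟩) ?_
    intro a ha
    refine h3 (e a) ?_
    rw [IsLocalRing.mem_maximalIdeal, mem_nonunits_iff] at ha ⊢
    intro hu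
    exact ha ((isUnit_map_iff e a).1 hu)) ((phi η U).hom j) ⟨j, rfl⟩ hj
  obtain ⟨b, rfl⟩ := e.surjective b
  refine ⟨a, b, ?_, ?_⟩
  · rw [IsLocalRing.mem_maximalIdeal, mem_nonunits_iff] at hb
    intro hu
    exact hb (hu.map e)
  · rw [map_mul]
    exact hab

lemma glue {X : Scheme.{0}} (U V : X.Opens) (s : Γ(X, U)) (t : Γ(X, V))
    (h : X.presheaf.map (homOfLE (inf_le_left : U ⊓ V ≤ U)).op s =
      X.presheaf.map (homOfLE (inf_le_right : U ⊓ V ≤ V)).op t) :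
    ∃ g : Γ(X, U ⊔ V), X.presheaf.map (homOfLE (le_sup_left : U ≤ U ⊔ V)).op g = s ∧
      X.presheaf.map (homOfLE (le_sup_right : V ≤ U ⊔ V)).op g = t := by
  exact ⟨(X.sheaf.objSupIsoProdEqLocus U V).inv ⟨(s, t), h⟩,
    X.sheaf.objSupIsoProdEqLocus_inv_fst U V _, X.sheaf.objSupIsoProdEqLocus_inv_snd U V _⟩

lemma extend_step [IsSeparated f] [LocallyOfFiniteType f] (htr : Algebra.trdeg k F ≤ 1)
    (hγ : gam η ≫ f = Spec.map (CommRingCat.ofHom (algebraMap k F)))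
    (V : ValuationSubring F) (hV : ∀ c : k, algebraMap k F c ∈ V) (hNC : NC (gam η) V)
    {U : C.Opens} [hne : Nonempty U] (hU : IsAffineOpen U) (z : C) (hz : z ∉ U) :
    ∃ Y : C.Opens, IsAffineOpen Y ∧ U < Y := by
  obtain ⟨N, hN, hzN, hNU⟩ := near_pt η f htr hγ U z
  have hNne : Nonempty N := ⟨⟨z, hzN⟩⟩
  obtain ⟨j, hjN, hjg⟩ := hU.exists_basicOpen_le ⟨genericPoint C, gp_mem N hNne⟩ (gp_mem U hne)
  have hj : (phi η U).hom j ≠ 0 := by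
    intro h0
    rw [← map_zero (phi η U).hom] at h0
    have := phi_inj η U h0
    rw [this, Scheme.basicOpen_zero] at hjg
    exact hjg
  obtain ⟨a, b, hb, hab⟩ := apply_core η f htr hγ V hV hNC hU z hz j hj
  obtain ⟨N', hzN', t', ht'⟩ := C.presheaf.exists_germ_eq (1 - b)
  let U1 := N' ⊓ N
  have hzU1 : z ∈ U1 := ⟨hzN', hzN⟩
  let t : Γ(C, U1) := C.presheaf.map (homOfLE (inf_le_left : U1 ≤ N')).op t'
  have ht : C.presheaf.germ U1 z hzU1 t = 1 - b := by
    rw [← ht']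
    exact TopCat.Presheaf.germ_res_apply _ _ _ _ _
  have hU1ne : Nonempty U1 := ⟨⟨z, hzU1⟩⟩
  have hUU1 : Nonempty (U ⊓ U1 : C.Opens) :=
    ⟨⟨genericPoint C, gp_mem U hne, gp_mem U1 hU1ne⟩⟩
  have htφ : (phi η U1).hom t = (phi η U).hom (j * a) := by
    have h1 : (theta η z).hom (C.presheaf.germ U1 z hzU1 t) = (phi η U1).hom t :=
      congrArg (fun q => q.hom t) (germ_theta η U1 z hzU1)
    rw [← h1, ht, map_sub, hab, map_one]
    ring
  obtain ⟨h, hs, hht⟩ := glue U U1 (j * a) t (by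
    apply phi_inj η (U ⊓ U1)
    have h1 := congrArg (fun q => q.hom (j * a)) (res_phi η (U ⊓ U1) U (homOfLE inf_le_left))
    have h2 := congrArg (fun q => q.hom t) (res_phi η (U ⊓ U1) U1 (homOfLE inf_le_right))
    exact h1.trans (htφ.symm.trans h2.symm))
  let Y := U ⊔ U1
  have hNY : N ≤ Y := by
    intro w hw
    by_cases hwU : w ∈ U
    · exact Or.inl hwU
    · rw [hNU w hw hwU]; exact Or.inr hzU1
  have hYz : ∀ w ∈ Y, w ∉ U → w = z := by
    rintro w (hw | hw) hwU
    · exact absurd hw hwU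
    · exact hNU w hw.2 hwU
  have hB1 : C.basicOpen h ≤ N := by
    intro w hw
    by_cases hwU : w ∈ U
    · have : w ∈ C.basicOpen (j * a) := by
        rw [← hs, Scheme.basicOpen_res]
        exact ⟨hwU, hw⟩
      rw [Scheme.basicOpen_mul] at this
      exact hjN this.1
    · rw [hYz w (C.basicOpen_le h hw) hwU]; exact hzN
  have hB2 : C.basicOpen (1 - h) ≤ U := by
    intro w hw
    by_contra hwU
    have hwz := hYz w (C.basicOpen_le _ hw) hwU
    subst hwz
    rw [Scheme.mem_basicOpen _ _ _ (Or.inr hzU1 : w ∈ Y)] at hw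
    apply hb
    have h1 : C.presheaf.germ Y w (Or.inr hzU1) h = C.presheaf.germ U1 w hzU1 t := by
      rw [← hht]
      exact (TopCat.Presheaf.germ_res_apply _ _ _ _ _).symm
    rw [map_sub, map_one, h1, ht] at hw
    simpa using hw
  refine ⟨Y, ?_, lt_of_le_of_ne le_sup_left ?_⟩
  · apply isAffineOpen_of_isAffineOpen_basicOpen Y {h, 1 - h}
    · rw [Ideal.eq_top_iff_one]
      have : (1 : Γ(C, Y)) = h + (1 - h) := by ring
      rw [this]
      exact Ideal.add_mem _ (Ideal.subset_span (by simp)) (Ideal.subset_span (by simp))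
    · rintro i (rfl | rfl)
      · have := hN.basicOpen (C.presheaf.map (homOfLE hNY).op i)
        rwa [Scheme.basicOpen_res, inf_eq_right.2 hB1] at this
      · have := hU.basicOpen (C.presheaf.map (homOfLE (le_sup_left : U ≤ Y)).op (1 - h))
        rwa [Scheme.basicOpen_res, inf_eq_right.2 hB2] at this
  · intro hUY
    apply hz
    rw [hUY]
    exact Or.inr hzU1

lemma isAffine_of_NC [IsSeparated f] [LocallyOfFiniteType f] [QuasiCompact f]
    (htr : Algebra.trdeg k F ≤ 1)
    (hγ : gam η ≫ f = Spec.map (CommRingCat.ofHom (algebraMap k F)))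
    (V : ValuationSubring F) (hV : ∀ c : k, algebraMap k F c ∈ V) (hNC : NC (gam η) V) :
    IsAffine C := by
  have : IsLocallyNoetherian C := LocallyOfFiniteType.isLocallyNoetherian f
  have : CompactSpace C := (quasiCompact_iff_compactSpace f).1 inferInstance
  have : IsNoetherian C := {}
  have : WellFoundedGT C.Opens := inferInstanceAs (WellFoundedGT (TopologicalSpace.Opens C))
  obtain ⟨_, ⟨U0, hU0 : IsAffineOpen U0, rfl⟩, hz0, -⟩ :=
    C.isBasis_affineOpens.exists_subset_of_mem_open (Set.mem_univ (genericPoint C)) isOpen_univ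
  obtain ⟨U, ⟨hU, hgU⟩, hmax⟩ := WellFounded.has_min (wellFounded_gt (α := C.Opens))
    {U | IsAffineOpen U ∧ genericPoint C ∈ U} ⟨U0, hU0, hz0⟩
  have hne : Nonempty U := ⟨⟨_, hgU⟩⟩
  have htop : U = ⊤ := by
    by_contra hn
    obtain ⟨z, hz⟩ : ∃ z, z ∉ U := by
      by_contra! hcon
      exact hn (top_le_iff.1 fun x _ => hcon x)
    obtain ⟨Y, hY, hlt⟩ := extend_step η f htr hγ V hV hNC hU z hz
    exact hmax Y ⟨hY, hlt.le hgU⟩ hlt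
  rw [htop] at hU
  have : IsAffine (⊤ : C.Opens) := hU
  exact IsAffine.of_isIso C.topIso.inv

end Geo6
end AffCurve
end

section
open AlgebraicGeometry CategoryTheory Opposite

namespace AffCurve
section Geo7

variable {C : Scheme.{0}} [IsIntegral C] {F : Type} [Field F]
  (η : C.functionField ≅ CommRingCat.of F)
variable {k : Type} [Field k] [Algebra k F] (f : C ⟶ Spec (CommRingCat.of k))

lemma preimage_top (f : C ⟶ Spec (CommRingCat.of k)) [IsAffine C] :
    Spec.preimage ((isAffineOpen_top C).fromSpec ≫ f) =
      (Scheme.ΓSpecIso (CommRingCat.of k)).inv ≫ f.appTop := by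
  apply Spec.map_injective
  rw [Spec.map_preimage, Spec.map_comp, IsAffineOpen.fromSpec_top, ← Scheme.isoSpec_inv_naturality,
    Scheme.isoSpec_Spec_inv]

lemma final_of_NC [IsAffine C] [LocallyOfFiniteType f]
    (htr : Algebra.trdeg k F ≤ 1)
    (hγ : gam η ≫ f = Spec.map (CommRingCat.ofHom (algebraMap k F)))
    (V : ValuationSubring F) (hV : ∀ c : k, algebraMap k F c ∈ V) (hNC : NC (gam η) V) :
    topologicalKrullDim C = 1 ∧
      ¬ RingHom.Finite ((Scheme.ΓSpecIso (CommRingCat.of k)).inv ≫ f.appTop).hom := by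
  have hU := isAffineOpen_top C
  have hne : Nonempty (⊤ : C.Opens) := ⟨⟨genericPoint C, trivial⟩⟩
  have h1 := kap η f hγ _ _ (phi_gam η hU)
  have h2 := kap_ft f hU
  rw [preimage_top] at h1 h2
  let κ : k →+* Γ(C, ⊤) := ((Scheme.ΓSpecIso (CommRingCat.of k)).inv ≫ f.appTop).hom
  let _ : Algebra k Γ(C, ⊤) := κ.toAlgebra
  have : Algebra.FiniteType k Γ(C, ⊤) := h2
  let ψ : Γ(C, ⊤) →ₐ[k] F := { (phi η ⊤).hom with
    commutes' := fun c => congrArg (fun t => t c) h1 }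
  obtain ⟨h3, h4⟩ := dim_eq_one ψ (phi_inj η ⊤) htr V hV
    (hNC.exists_not_mem _ _ (phi_gam η hU))
  refine ⟨?_, h4⟩
  rw [(Scheme.homeoOfIso C.isoSpec).isHomeomorph.topologicalKrullDim_eq _, ← h3]
  exact PrimeSpectrum.topologicalKrullDim_eq_ringKrullDim _

end Geo7
end AffCurve
end

open AlgebraicGeometry CategoryTheory Opposite

/-- Let `k` be a field and `X` a scheme which is separated and of finite type over `k` but
not proper over `k`. Then there exists a closed subscheme `C` of `X` (a scheme `C` with a
closed immersion `C ⟶ X`) which is affine, integral, and of Krull dimension one; in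
particular the `k`-vector space `Γ(C, O_C)` is infinite-dimensional over `k`. -/
theorem exists_affine_closed_curve_of_not_proper
    (k : Type) [Field k] (X : Scheme) (f : X ⟶ Spec (CommRingCat.of k))
    [IsSeparated f] [LocallyOfFiniteType f] [QuasiCompact f]
    (hnp : ¬ IsProper f) :
    ∃ (C : Scheme) (i : C ⟶ X), IsClosedImmersion i ∧ IsAffine C ∧ IsIntegral C ∧
      topologicalKrullDim C = 1 ∧
      ¬ RingHom.Finite ((Scheme.ΓSpecIso (CommRingCat.of k)).inv ≫ (i ≫ f).appTop).hom := by
  obtain ⟨K, _, _, V0, g, hV0, hg, hNC0⟩ := AffCurve.exists_NC k X f hnp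
  obtain ⟨L, _, _, W, g', htrL, hW, hg', hNC1⟩ :=
    AffCurve.exists_curve_NC k X f K V0 g hV0 hg hNC0
  obtain ⟨C, i, hC, F, _, _, V, η, hi, htr, hV, hγ, hNC⟩ :=
    AffCurve.exists_integral_NC k X f L W g' htrL hW hg' hNC1
  have haff : IsAffine C := AffCurve.isAffine_of_NC η (i ≫ f) htr hγ V hV hNC
  obtain ⟨h1, h2⟩ := AffCurve.final_of_NC η (i ≫ f) htr hγ V hV hNC
  exact ⟨C, i, hi, haff, hC, h1, h2⟩
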